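/- arXiv:2008.00685 — 2 statements merged into one kernel-verified Lean document; each statement's English description precedes it below -/
import Mathlib

section
/- Let σ>1, let U ⊂ ℝ^d be open, Γ ⊆ ℝ^d∖{0} an open cone, 0<γ<1/e, and let F : Z → ℂ be holomorphic on Z = {z ∈ ℂ^d : Re z ∈ U, Im z ∈ Γ, |Im z| < γ}. Assume there exist A, H > 0 such that |F(z)| ≤ A · |Im z|^{−H (ln(1/|Im z|) / ln(ln(1/|Im z|)))^{1/(σ−1)}} for all z ∈ Z with |Im z| < e^{−e}. Then for every compact K ⊂ U, every Y ∈ Γ with |Y| < γ, and every smooth φ : ℝ^d → ℂ with supp φ ⊆ K and ‖φ‖_{τ',σ,h;K} < ∞ for every τ'>0 and every h>0, the limit L(φ) = lim_{t→0⁺} ∫_K F(x+itY) φ(x) dx exists; moreover there exist τ''>0, h>0 and B>0, independent of φ, such that |L(φ)| ≤ B · ‖φ‖_{τ'',σ,h;K} for all such φ. -/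
open scoped ENNReal Topology

/-- Partial derivative in the `i`-th coordinate direction of `f : ℝ^d → ℂ`. -/
noncomputable def pder {d : ℕ} (i : Fin d) (f : (Fin d → ℝ) → ℂ) : (Fin d → ℝ) → ℂ :=
  fun x => fderiv ℝ f x (Pi.single i 1)

/-- The length `|α| = α₁ + … + α_d` of a multi-index `α ∈ ℕ^d`. -/
def msize {d : ℕ} (α : Fin d → ℕ) : ℕ := ∑ i, α i

/-- Multi-index partial derivative `∂^α f` of `f : ℝ^d → ℂ`. -/
noncomputable def mder {d : ℕ} (α : Fin d → ℕ) (f : (Fin d → ℝ) → ℂ) : (Fin d → ℝ) → ℂ :=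
  (List.finRange d).foldr (fun i g => (pder i)^[α i] g) f

/-- Euclidean norm on `ℝ^d`. -/
noncomputable def vnorm {d : ℕ} (y : Fin d → ℝ) : ℝ := Real.sqrt (∑ i, y i ^ 2)

/-- The norm `‖φ‖_{τ,σ,h;K} = sup_α sup_{x∈K} |∂^α φ(x)| / (h^{|α|^σ} |α|^{τ|α|^σ})`,
valued in `ℝ≥0∞`; the `α = 0` term is `sup_{x∈K} |φ(x)|`. -/
noncomputable def GNorm {d : ℕ} (τ σ h : ℝ) (K : Set (Fin d → ℝ))
    (φ : (Fin d → ℝ) → ℂ) : ℝ≥0∞ :=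
  ⨆ (α : Fin d → ℕ), ⨆ x ∈ K, ENNReal.ofReal
    (‖mder α φ x‖ /
      (h ^ ((msize α : ℝ) ^ σ) * (msize α : ℝ) ^ (τ * (msize α : ℝ) ^ σ)))

section Osgood

open Metric Asymptotics Filter

variable {d : ℕ} {F : (Fin d → ℂ) → ℂ} {Z : Set (Fin d → ℂ)}

lemma differentiableAt_add_single
    (hsep : ∀ z ∈ Z, ∀ j, DifferentiableAt ℂ (fun w : ℂ => F (z + Pi.single j w)) 0)
    {x : Fin d → ℂ} {j : Fin d} {w : ℂ} (hx : x + Pi.single j w ∈ Z) :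
    DifferentiableAt ℂ (fun w : ℂ => F (x + Pi.single j w)) w := by
  have h := hsep _ hx j
  have h2 : DifferentiableAt ℂ (fun w' : ℂ => w' - w) w := by fun_prop
  have h3 : DifferentiableAt ℂ (fun w' : ℂ => F (x + Pi.single j w + Pi.single j w'))
    ((fun w' : ℂ => w' - w) w) := by simpa using h
  have h4 := DifferentiableAt.comp (f := fun w' : ℂ => w' - w) w h3 h2
  refine h4.congr_of_eventuallyEq (Eventually.of_forall fun w' => ?_)
  simp only [Function.comp_apply, add_assoc, ← Pi.single_add, add_sub_cancel]

lemma norm_single_le {j : Fin d} (w : ℂ) : ‖(Pi.single j w : Fin d → ℂ)‖ ≤ ‖w‖ :=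
  (Pi.norm_single (G := fun _ : Fin d => ℂ) w).le

lemma dist_add_single_le {z x : Fin d → ℂ} {j : Fin d} {w : ℂ} {r s : ℝ}
    (hx : x ∈ ball z r) (hw : ‖w‖ < s) : x + Pi.single j w ∈ ball z (r + s) := by
  rw [mem_ball, dist_eq_norm] at *
  calc ‖x + Pi.single j w - z‖ = ‖(x - z) + Pi.single j w‖ := by congr 1; abel
    _ ≤ _ := norm_add_le _ _
    _ < _ := add_lt_add_of_lt_of_le hx ((norm_single_le w).trans hw.le)

lemma dist_add_single_le_of_sep
    (hsep : ∀ z ∈ Z, ∀ j, DifferentiableAt ℂ (fun w : ℂ => F (z + Pi.single j w)) 0)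
    {z : Fin d → ℂ} {ρ M : ℝ} (hρ : 0 < ρ) (hZ : ball z (2 * ρ) ⊆ Z)
    (hM : ∀ x ∈ ball z (2 * ρ), ‖F x‖ ≤ M) {x : Fin d → ℂ} (hx : x ∈ ball z ρ)
    {j : Fin d} {w : ℂ} (hw : ‖w‖ < ρ) :
    ‖F (x + Pi.single j w) - F x‖ ≤ 2 * M / ρ * ‖w‖ := by
  have hmem : ∀ w : ℂ, ‖w‖ < ρ → x + Pi.single j w ∈ ball z (2 * ρ) := fun w hw => by
    rw [two_mul]; exact dist_add_single_le hx hw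
  have := Complex.dist_le_div_mul_dist_of_mapsTo_ball (f := fun w => F (x + Pi.single j w))
    (c := 0) (R₁ := ρ) (R₂ := 2 * M) (z := w) ?_ ?_ (by simpa using hw)
  · simpa [dist_eq_norm] using this
  · intro w' hw'
    exact (differentiableAt_add_single hsep (hZ (hmem w' (by simpa using hw')))).differentiableWithinAt
  · intro w' hw'
    rw [mem_closedBall, dist_eq_norm]
    have h1 := hM _ (hmem w' (by simpa using hw'))
    have h2 := hM _ (hmem 0 (by simpa using hρ))
    calc _ ≤ _ := norm_sub_le _ _
      _ ≤ 2 * M := by linarith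

lemma piecewise_mem_ball {z x y : Fin d → ℂ} {r : ℝ} (hx : x ∈ ball z r) (hy : y ∈ ball z r)
    (S : Finset (Fin d)) : S.piecewise x y ∈ ball z r := by
  have hr : 0 < r := pos_of_mem_ball hx
  rw [mem_ball, dist_pi_lt_iff hr] at *
  intro b
  by_cases hb : b ∈ S <;> simp [hb, hx b, hy b]

lemma piecewise_insert_eq {x y : Fin d → ℂ} {S : Finset (Fin d)} {j : Fin d} (hj : j ∉ S) :
    (insert j S).piecewise x y = S.piecewise x y + Pi.single j (x j - y j) := by
  ext b
  by_cases hb : b = j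
  · subst hb; simp [hj]
  · simp [hb, Finset.piecewise]

lemma norm_sub_le_of_sep
    (hsep : ∀ z ∈ Z, ∀ j, DifferentiableAt ℂ (fun w : ℂ => F (z + Pi.single j w)) 0)
    {z : Fin d → ℂ} {ρ M : ℝ} (hρ : 0 < ρ) (hZ : ball z (2 * ρ) ⊆ Z)
    (hM : ∀ x ∈ ball z (2 * ρ), ‖F x‖ ≤ M) {x y : Fin d → ℂ} (hx : x ∈ ball z (ρ / 2))
    (hy : y ∈ ball z (ρ / 2)) :
    ‖F x - F y‖ ≤ d * (2 * M / ρ) * ‖x - y‖ := by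
  have hM0 : 0 ≤ M := (norm_nonneg _).trans (hM z (mem_ball_self (by positivity)))
  have key : ∀ S : Finset (Fin d),
      ‖F (S.piecewise x y) - F y‖ ≤ S.card * (2 * M / ρ) * ‖x - y‖ := by
    intro S
    induction S using Finset.induction_on with
    | empty => simp
    | insert j S hj ih =>
      rw [piecewise_insert_eq hj, Finset.card_insert_of_notMem hj]
      have hw : ‖x j - y j‖ ≤ ‖x - y‖ := norm_le_pi_norm (x - y) j
      have hlt : ‖x - y‖ < ρ := by
        rw [← dist_eq_norm]
        calc dist x y ≤ dist x z + dist y z := dist_triangle_right _ _ _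
          _ < ρ := by rw [mem_ball] at hx hy; linarith
      have h1 := dist_add_single_le_of_sep hsep hρ hZ hM
        (ball_subset_ball (by linarith) (piecewise_mem_ball hx hy S)) (j := j) (hw.trans_lt hlt)
      calc _ = ‖(F (S.piecewise x y + Pi.single j (x j - y j)) - F (S.piecewise x y)) +
            (F (S.piecewise x y) - F y)‖ := by congr 1; abel
        _ ≤ _ := norm_add_le _ _
        _ ≤ 2 * M / ρ * ‖x - y‖ + S.card * (2 * M / ρ) * ‖x - y‖ := by
          gcongr
          exact h1.trans (by gcongr)
        _ = _ := by push_cast; ring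
  simpa using key Finset.univ

lemma tendsto_deriv_of_sep
    (hsep : ∀ z ∈ Z, ∀ j, DifferentiableAt ℂ (fun w : ℂ => F (z + Pi.single j w)) 0)
    {z : Fin d → ℂ} {ρ M : ℝ} (hρ : 0 < ρ) (hZ : ball z (2 * ρ) ⊆ Z)
    (hM : ∀ x ∈ ball z (2 * ρ), ‖F x‖ ≤ M) (j : Fin d) :
    Tendsto (fun x => deriv (fun w : ℂ => F (x + Pi.single j w)) 0) (𝓝 z)
      (𝓝 (deriv (fun w : ℂ => F (z + Pi.single j w)) 0)) := by
  rw [tendsto_iff_norm_sub_tendsto_zero]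
  have hlim : Tendsto (fun x : Fin d → ℂ => d * (2 * M / ρ) * ‖x - z‖ / (ρ / 8)) (𝓝 z) (𝓝 0) := by
    have : Continuous (fun x : Fin d → ℂ => d * (2 * M / ρ) * ‖x - z‖ / (ρ / 8)) := by fun_prop
    simpa using this.tendsto z
  refine squeeze_zero' (Eventually.of_forall fun _ => norm_nonneg _) ?_ hlim
  filter_upwards [ball_mem_nhds z (show 0 < ρ / 4 by positivity)] with x hx
  have hmem : ∀ y ∈ ball z (ρ / 4), ∀ w : ℂ, ‖w‖ < ρ / 4 → y + Pi.single j w ∈ ball z (ρ / 2) :=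
    fun y hy w hw => by
      have := dist_add_single_le (j := j) hy hw
      rwa [show ρ / 4 + ρ / 4 = ρ / 2 by ring] at this
  have hzz : z ∈ ball z (ρ / 4) := mem_ball_self (by positivity)
  have hdiff : ∀ y ∈ ball z (ρ / 4), ∀ w : ℂ, ‖w‖ < ρ / 4 →
      DifferentiableAt ℂ (fun w : ℂ => F (y + Pi.single j w)) w := fun y hy w hw =>
    differentiableAt_add_single hsep (hZ (ball_subset_ball (by linarith) (hmem y hy w hw)))
  have h0 : ‖(0 : ℂ)‖ < ρ / 4 := by simpa using hρ
  rw [← deriv_fun_sub (hdiff x hx 0 h0) (hdiff z hzz 0 h0)]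
  refine Complex.norm_deriv_le_of_forall_mem_sphere_norm_le (by positivity) ?_ ?_
  · refine DifferentiableOn.diffContOnCl_ball (U := ball 0 (ρ / 4)) ?_
      (closedBall_subset_ball (by linarith))
    intro w hw
    have hw : ‖w‖ < ρ / 4 := by simpa using hw
    exact ((hdiff x hx w hw).sub (hdiff z hzz w hw)).differentiableWithinAt
  · intro w hw
    have hw : ‖w‖ < ρ / 4 := by
      have : ‖w‖ = ρ / 8 := by simpa using hw
      linarith
    have := norm_sub_le_of_sep hsep hρ hZ hM (hmem x hx w hw) (hmem z hzz w hw)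
    simpa using this

lemma isLittleO_of_tendsto_deriv {α : Type*} {l : Filter α} {f f' : α → ℂ → ℂ} {D : ℂ}
    {v : α → ℂ} (hv : Tendsto v l (𝓝 0))
    (hf : ∀ᶠ p : α × ℂ in l ×ˢ 𝓝 0, HasDerivAt (f p.1) (f' p.1 p.2) p.2)
    (hlim : Tendsto (fun p : α × ℂ => f' p.1 p.2) (l ×ˢ 𝓝 0) (𝓝 D)) :
    (fun x => f x (v x) - f x 0 - v x * D) =o[l] v := by
  rw [isLittleO_iff]
  intro ε hε
  obtain ⟨pa, hpa, pb, hpb, hp⟩ := eventually_prod_iff.1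
    (hf.and (Metric.tendsto_nhds.1 hlim ε hε))
  obtain ⟨δ, hδ, hball⟩ := Metric.mem_nhds_iff.1 hpb
  filter_upwards [hpa, hv (ball_mem_nhds 0 hδ)] with x hxa hx
  have := Convex.norm_image_sub_le_of_norm_hasDerivWithin_le (s := ball (0 : ℂ) δ)
    (f := fun w => f x w - w * D) (f' := fun w => f' x w - D) (C := ε)
    (fun w hw => by
      simpa using! ((hp hxa (hball hw)).1.sub ((hasDerivAt_id w).mul_const D)).hasDerivWithinAt)
    (fun w hw => by
      rw [← dist_eq_norm]
      exact (hp hxa (hball hw)).2.le)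
    (convex_ball (0 : ℂ) δ) (mem_ball_self hδ) hx
  calc _ ≤ _ := le_of_eq (by congr 1; ring)
    _ ≤ _ := this
    _ = _ := by rw [sub_zero]

/-- **Osgood's lemma**: a locally bounded separately holomorphic function is holomorphic. -/
theorem differentiableAt_of_separately
    (hsep : ∀ z ∈ Z, ∀ j, DifferentiableAt ℂ (fun w : ℂ => F (z + Pi.single j w)) 0)
    {z : Fin d → ℂ} {ρ M : ℝ} (hρ : 0 < ρ) (hZ : ball z (2 * ρ) ⊆ Z)
    (hM : ∀ x ∈ ball z (2 * ρ), ‖F x‖ ≤ M) : DifferentiableAt ℂ F z := by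
  set D : Fin d → ℂ := fun j => deriv (fun w : ℂ => F (z + Pi.single j w)) 0 with hD
  have key : ∀ S : Finset (Fin d),
      (fun x => F (S.piecewise x z) - F z - ∑ j ∈ S, (x j - z j) * D j) =o[𝓝 z]
        (fun x => x - z) := by
    intro S
    induction S using Finset.induction_on with
    | empty => simp
    | insert j S hj ih =>
      have hpw : Tendsto (fun x => S.piecewise x z) (𝓝 z) (𝓝 z) := by
        have : Continuous (fun x : Fin d → ℂ => S.piecewise x z) := by
          refine continuous_pi fun b => ?_
          by_cases hb : b ∈ S
          · simpa [hb] using continuous_apply b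
          · simpa [hb] using continuous_const
        have h0 : S.piecewise z z = z := by ext b; simp [Finset.piecewise]
        simpa only [h0] using this.tendsto z
      have hev : ∀ᶠ p : (Fin d → ℂ) × ℂ in 𝓝 z ×ˢ 𝓝 0,
          S.piecewise p.1 z + Pi.single j p.2 ∈ ball z (2 * ρ) := by
        have h1 : ∀ᶠ x in 𝓝 z, S.piecewise x z ∈ ball z ρ := hpw (ball_mem_nhds z hρ)
        have h2 : ∀ᶠ w : ℂ in 𝓝 0, w ∈ ball (0 : ℂ) ρ := ball_mem_nhds 0 hρ
        filter_upwards [h1.prod_mk h2] with p hp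
        rw [two_mul]
        exact dist_add_single_le hp.1 (by simpa using hp.2)
      have hv : Tendsto (fun x : Fin d → ℂ => x j - z j) (𝓝 z) (𝓝 0) := by
        have : Continuous (fun x : Fin d → ℂ => x j - z j) := by fun_prop
        simpa using this.tendsto z
      have hO : (fun x : Fin d → ℂ => x j - z j) =O[𝓝 z] (fun x => x - z) :=
        IsBigO.of_bound 1 (Eventually.of_forall fun x => by
          simpa using norm_le_pi_norm (x - z) j)
      have hstep := (isLittleO_of_tendsto_deriv
        (f := fun x w => F (S.piecewise x z + Pi.single j w))
        (f' := fun x w =>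
          deriv (fun w' : ℂ => F ((S.piecewise x z + Pi.single j w) + Pi.single j w')) 0)
        (D := D j) hv ?_ ?_).trans_isBigO hO
      · refine (hstep.add ih).congr_left fun x => ?_
        rw [Finset.sum_insert hj, piecewise_insert_eq hj, Pi.single_zero, add_zero]
        ring
      · filter_upwards [hev] with p hp
        have h := deriv_comp_const_add (fun w : ℂ => F (S.piecewise p.1 z + Pi.single j w)) p.2 0
        simp only [Pi.single_add, add_zero, ← add_assoc] at h
        rw [h]
        exact (differentiableAt_add_single hsep (hZ hp)).hasDerivAt
      · refine (tendsto_deriv_of_sep hsep hρ hZ hM j).comp ?_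
        have h1 := hpw.comp (tendsto_fst (f := 𝓝 z) (g := 𝓝 (0 : ℂ)))
        have h2 : Tendsto (fun w : ℂ => (Pi.single j w : Fin d → ℂ)) (𝓝 0) (𝓝 0) := by
          have := (continuous_single (A := fun _ : Fin d => ℂ) j).tendsto 0
          simpa using this
        simpa using h1.add (h2.comp (tendsto_snd (f := 𝓝 z) (g := 𝓝 (0 : ℂ))))
  refine HasFDerivAt.differentiableAt
    (f' := ∑ j, (ContinuousLinearMap.proj j : (Fin d → ℂ) →L[ℂ] ℂ).smulRight (D j)) ?_
  rw [hasFDerivAt_iff_isLittleO]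
  refine (key Finset.univ).congr_left fun x => ?_
  simp

end Osgood

section Telescoping

open Set Finset

/-- The Taylor polynomial of order `n` at `x`, evaluated at `t`, of a function whose successive
derivatives are `I 0, I 1, …`. -/
noncomputable def taylorSum (I : ℕ → ℝ → ℂ) (n : ℕ) (t x : ℝ) : ℂ :=
  ∑ k ∈ range n, I k x * (((t - x) ^ k / (k.factorial : ℝ) : ℝ) : ℂ)

lemma taylorSum_self (I : ℕ → ℝ → ℂ) {n : ℕ} (hn : 1 ≤ n) (t : ℝ) :
    taylorSum I n t t = I 0 t := by
  obtain ⟨m, rfl⟩ := Nat.exists_eq_add_of_le' hn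
  simp [taylorSum, Finset.sum_range_succ']

lemma hasDerivAt_taylorSum {I : ℕ → ℝ → ℂ} {x : ℝ}
    (hI : ∀ k, HasDerivAt (I k) (I (k + 1) x) x) (n : ℕ) (t : ℝ) :
    HasDerivAt (taylorSum I (n + 1) t)
      (I (n + 1) x * (((t - x) ^ n / (n.factorial : ℝ) : ℝ) : ℂ)) x := by
  induction n with
  | zero =>
    have h : taylorSum I (0 + 1) t = I 0 := by funext x; simp [taylorSum]
    simpa [h] using hI 0
  | succ n ih =>
    have hpow : HasDerivAt (fun x : ℝ => (t - x) ^ (n + 1) / ((n + 1).factorial : ℝ))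
        (-((t - x) ^ n / (n.factorial : ℝ))) x := by
      have h := (((hasDerivAt_id x).const_sub t).pow (n + 1)).div_const ((n + 1).factorial : ℝ)
      refine h.congr_deriv ?_
      rw [Nat.factorial_succ]
      push_cast
      field_simp
      simp
    have h := ih.add ((hI (n + 1)).mul hpow.ofReal_comp)
    have heq : taylorSum I (n + 1 + 1) t = fun x => taylorSum I (n + 1) t x +
        I (n + 1) x * (((t - x) ^ (n + 1) / ((n + 1).factorial : ℝ) : ℝ) : ℂ) := by
      funext x
      rw [taylorSum, Finset.sum_range_succ, taylorSum]
    rw [heq]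
    refine h.congr_deriv ?_
    push_cast
    ring

lemma norm_taylor_coeff_le {t x s : ℝ} (ht : 0 ≤ t) (htx : t ≤ x) (hx : x ≤ s) (k : ℕ) :
    ‖(((t - x) ^ k / (k.factorial : ℝ) : ℝ) : ℂ)‖ ≤ s ^ k := by
  rw [Complex.norm_real, norm_div, norm_pow, Real.norm_eq_abs, Real.norm_eq_abs, abs_sub_comm,
    abs_of_nonneg (sub_nonneg.2 htx), Nat.abs_cast]
  calc (x - t) ^ k / (k.factorial : ℝ) ≤ (x - t) ^ k :=
        div_le_self (pow_nonneg (sub_nonneg.2 htx) _) (by exact_mod_cast k.factorial_pos)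
    _ ≤ s ^ k := pow_le_pow_left₀ (sub_nonneg.2 htx) (by linarith) _

lemma norm_taylorSum_sub_le {I : ℕ → ℝ → ℂ} {T : ℝ}
    (hI : ∀ k, ∀ x, 0 < x → x < T → HasDerivAt (I k) (I (k + 1) x) x)
    {n : ℕ} (hn : 1 ≤ n) {t u s b : ℝ} (ht : 0 < t) (htu : t ≤ u) (hus : u ≤ s) (hs : s < T)
    (hb : ∀ x, u ≤ x → x ≤ s → ‖I n x‖ ≤ b) :
    ‖taylorSum I n t u - taylorSum I n t s‖ ≤ b * s ^ n := by
  obtain ⟨m, rfl⟩ := Nat.exists_eq_add_of_le' hn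
  have hb0 : 0 ≤ b := (norm_nonneg _).trans (hb u le_rfl hus)
  have hs0 : 0 ≤ s := by linarith
  have := Convex.norm_image_sub_le_of_norm_hasDerivWithin_le (s := Set.Icc u s)
    (f := taylorSum I (m + 1) t)
    (f' := fun x => I (m + 1) x * (((t - x) ^ m / (m.factorial : ℝ) : ℝ) : ℂ)) (C := b * s ^ m)
    (fun x hx => (hasDerivAt_taylorSum
      (fun k => hI k x (by linarith [hx.1]) (by linarith [hx.2])) m t).hasDerivWithinAt)
    (fun x hx => by
      rw [norm_mul]
      exact mul_le_mul (hb x hx.1 hx.2) (norm_taylor_coeff_le ht.le (htu.trans hx.1) hx.2 m)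
        (norm_nonneg _) hb0)
    (convex_Icc u s) (right_mem_Icc.2 hus) (left_mem_Icc.2 hus)
  refine this.trans ?_
  rw [Real.norm_eq_abs, abs_sub_comm, abs_of_nonneg (sub_nonneg.2 hus), pow_succ, ← mul_assoc]
  gcongr
  linarith

lemma norm_taylorSum_le_sum {I : ℕ → ℝ → ℂ} {T : ℝ}
    (hI : ∀ k, ∀ x, 0 < x → x < T → HasDerivAt (I k) (I (k + 1) x) x)
    {N : ℕ} (hN : 1 ≤ N) {s b : ℕ → ℝ} (hsT : ∀ n, N ≤ n → s n < T)
    (hanti : ∀ n, N ≤ n → s (n + 1) ≤ s n)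
    (hb : ∀ n, N ≤ n → ∀ x, s (n + 1) ≤ x → x ≤ s n → ‖I n x‖ ≤ b n)
    {n : ℕ} (hn : N ≤ n) {t : ℝ} (ht : 0 < t) (htn : t ≤ s n) :
    ‖taylorSum I n t (s n)‖ ≤ ‖taylorSum I N t (s N)‖ + ∑ k ∈ Ico N n, 2 * (b k * s k ^ k) := by
  induction n, hn using Nat.le_induction with
  | base => simp
  | succ n hn ih =>
    have hle := hanti n hn
    specialize ih (htn.trans hle)
    have h1 := norm_taylorSum_sub_le hI (hN.trans hn) ht htn hle (hsT n hn) (hb n hn)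
    have h2 : taylorSum I (n + 1) t (s (n + 1)) - taylorSum I n t (s (n + 1)) =
        I n (s (n + 1)) * (((t - s (n + 1)) ^ n / (n.factorial : ℝ) : ℝ) : ℂ) := by
      rw [taylorSum, Finset.sum_range_succ, taylorSum]; ring
    have hb0 := hb n hn _ le_rfl hle
    have h3 : ‖taylorSum I (n + 1) t (s (n + 1)) - taylorSum I n t (s (n + 1))‖ ≤
        b n * s n ^ n := by
      rw [h2, norm_mul]
      exact mul_le_mul hb0 (norm_taylor_coeff_le ht.le htn hle n)
        (norm_nonneg _) ((norm_nonneg _).trans hb0)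
    rw [Finset.sum_Ico_succ_top hn]
    have h4 : taylorSum I (n + 1) t (s (n + 1)) =
        (taylorSum I (n + 1) t (s (n + 1)) - taylorSum I n t (s (n + 1))) +
        (taylorSum I n t (s (n + 1)) - taylorSum I n t (s n)) + taylorSum I n t (s n) := by ring
    have h5 := norm_add₃_le (a := taylorSum I (n + 1) t (s (n + 1)) - taylorSum I n t (s (n + 1)))
      (b := taylorSum I n t (s (n + 1)) - taylorSum I n t (s n)) (c := taylorSum I n t (s n))
    rw [← h4] at h5
    linarith

lemma norm_le_of_scales {I : ℕ → ℝ → ℂ} {T : ℝ}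
    (hI : ∀ k, ∀ x, 0 < x → x < T → HasDerivAt (I k) (I (k + 1) x) x)
    {N : ℕ} (hN : 1 ≤ N) {s b : ℕ → ℝ} (hsT : ∀ n, N ≤ n → s n < T)
    (hanti : ∀ n, N ≤ n → s (n + 1) ≤ s n) (hlim : Filter.Tendsto s Filter.atTop (𝓝 0))
    (hb : ∀ n, N ≤ n → ∀ x, s (n + 1) ≤ x → x ≤ s n → ‖I n x‖ ≤ b n)
    {S : ℝ} (hS : ∀ n, ∑ k ∈ Ico N n, 2 * (b k * s k ^ k) ≤ S)
    {t : ℝ} (ht : 0 < t) (htN : t ≤ s N) :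
    ‖I 0 t‖ ≤ (∑ k ∈ range N, ‖I k (s N)‖ * s N ^ k) + S := by
  classical
  have hex : ∃ n, N ≤ n ∧ s (n + 1) < t := by
    have h1 := (hlim.comp (Filter.tendsto_add_atTop_nat 1)).eventually (gt_mem_nhds ht)
    obtain ⟨n, h2, h3⟩ := ((Filter.eventually_ge_atTop N).and h1).exists
    exact ⟨n, h2, h3⟩
  obtain ⟨hn, hlt⟩ := Nat.find_spec hex
  set n := Nat.find hex with hndef
  have htn : t ≤ s n := by
    rcases hn.eq_or_lt with h | h
    · rwa [← h]
    · by_contra hcon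
      push Not at hcon
      refine Nat.find_min hex (m := n - 1) (by omega) ⟨by omega, ?_⟩
      rwa [show n - 1 + 1 = n by omega]
  have h1 := norm_taylorSum_le_sum hI hN hsT hanti hb hn ht htn
  have h2 := norm_taylorSum_sub_le hI (hN.trans hn) ht le_rfl htn (hsT n hn)
    (fun x hx hxs => hb n hn x (hlt.le.trans hx) hxs)
  rw [taylorSum_self I (hN.trans hn)] at h2
  have h3 : ‖I 0 t‖ ≤ ‖I 0 t - taylorSum I n t (s n)‖ + ‖taylorSum I n t (s n)‖ := by
    simpa using norm_add_le (I 0 t - taylorSum I n t (s n)) (taylorSum I n t (s n))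
  have h4 := hS (n + 1)
  rw [Finset.sum_Ico_succ_top hn] at h4
  have h5 : ‖taylorSum I N t (s N)‖ ≤ ∑ k ∈ range N, ‖I k (s N)‖ * s N ^ k := by
    refine (norm_sum_le _ _).trans (Finset.sum_le_sum fun k _ => ?_)
    rw [norm_mul]
    gcongr
    exact norm_taylor_coeff_le ht.le htN le_rfl k
  have h6 : 0 ≤ b n * s n ^ n := (norm_nonneg _).trans h2
  linarith

end Telescoping

section Scales

open Real

/-- The logarithmic scale `c n^λ log n`. -/
noncomputable def logScale (c lam : ℝ) (n : ℕ) : ℝ := c * (n : ℝ) ^ lam * log n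

lemma logScale_mono {c lam : ℝ} (hc : 0 < c) (hlam : 0 < lam) {m n : ℕ} (hm : 1 ≤ m)
    (hmn : m ≤ n) : logScale c lam m ≤ logScale c lam n := by
  have h1 : (1 : ℝ) ≤ m := by exact_mod_cast hm
  have h2 : (m : ℝ) ≤ n := by exact_mod_cast hmn
  have := log_nonneg h1
  unfold logScale
  gcongr

lemma tendsto_logScale {c lam : ℝ} (hc : 0 < c) (hlam : 0 < lam) :
    Filter.Tendsto (logScale c lam) Filter.atTop Filter.atTop := by
  have h1 : Filter.Tendsto (fun x : ℝ => c * x ^ lam * log x) Filter.atTop Filter.atTop :=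
    ((tendsto_rpow_atTop hlam).const_mul_atTop hc).atTop_mul_atTop₀ tendsto_log_atTop
  exact h1.comp tendsto_natCast_atTop_atTop

lemma log_succ_le {n : ℕ} (hn : 2 ≤ n) : log ((n + 1 : ℕ) : ℝ) ≤ 2 * log n := by
  have h : ((n + 1 : ℕ) : ℝ) ≤ (n : ℝ) ^ 2 := by
    have : n + 1 ≤ n ^ 2 := by nlinarith
    exact_mod_cast this
  calc log ((n + 1 : ℕ) : ℝ) ≤ log ((n : ℝ) ^ 2) := log_le_log (by positivity) h
    _ = 2 * log n := by rw [log_pow]; norm_num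

lemma logScale_succ_le {c lam : ℝ} (hc : 0 < c) (hlam : 0 < lam) {n : ℕ} (hn : 2 ≤ n) :
    logScale c lam (n + 1) ≤ 2 ^ (lam + 1) * logScale c lam n := by
  have h1 : ((n + 1 : ℕ) : ℝ) ≤ 2 * n := by
    have : n + 1 ≤ 2 * n := by omega
    exact_mod_cast this
  have h0 : 0 ≤ log ((n + 1 : ℕ) : ℝ) := log_nonneg (by push_cast; linarith [n.cast_nonneg (α := ℝ)])
  calc logScale c lam (n + 1) ≤ c * (2 * n) ^ lam * (2 * log n) := by
        unfold logScale
        have := log_succ_le hn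
        gcongr
    _ = _ := by
        rw [mul_rpow (by norm_num) (by positivity), rpow_add (by norm_num), rpow_one, logScale]
        ring

lemma growth_le {lam H c : ℝ} (hlam : 0 < lam) (hH : 0 < H)
    (hc : c = lam / 2 ^ (lam + 1) * (1 / (2 * H * 2 ^ (lam + 1))) ^ lam) {n : ℕ} (hn : 2 ≤ n)
    (hcn : 1 ≤ c * log n) {v : ℝ} (hv : 0 < v) (h1 : logScale c lam n ≤ log (1 / v))
    (h2 : log (1 / v) ≤ logScale c lam (n + 1)) :
    v ^ (-(H * (log (1 / v) / log (log (1 / v))) ^ (1 / lam))) ≤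
      exp (n * logScale c lam n / 2) := by
  set Q : ℝ := 2 ^ (lam + 1) with hQ
  have hQ0 : 0 < Q := by positivity
  have hc0 : 0 < c := by rw [hc]; positivity
  have hn1 : (2 : ℝ) ≤ n := by exact_mod_cast hn
  have hn0 : (0 : ℝ) < n := by linarith
  have hlogn : 0 < log n := log_pos (by linarith)
  have hℓ : (n : ℝ) ^ lam ≤ logScale c lam n := by
    have : (n : ℝ) ^ lam * 1 ≤ (n : ℝ) ^ lam * (c * log n) := by gcongr
    unfold logScale; linarith
  have hnl : 0 < (n : ℝ) ^ lam := by positivity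
  set L := log (1 / v) with hL
  have hL0 : 0 < L := by linarith
  have hlogL : lam * log n ≤ log L := by
    rw [← log_rpow hn0]
    exact log_le_log hnl (hℓ.trans h1)
  have hLQ : L ≤ Q * logScale c lam n := h2.trans (logScale_succ_le hc0 hlam hn)
  have hquot : L / log L ≤ (1 / (2 * H * Q) * n) ^ lam := by
    have hpos : 0 < lam * log n := by positivity
    rw [div_le_iff₀ (hpos.trans_le hlogL)]
    calc L ≤ Q * logScale c lam n := hLQ
      _ = (1 / (2 * H * Q) * n) ^ lam * (lam * log n) := by
          rw [mul_rpow (by positivity) hn0.le, logScale, hc]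
          field_simp
      _ ≤ _ := by gcongr
  have hlogL0 : 0 < log L := (by positivity : 0 < lam * log n).trans_le hlogL
  have hpow : (L / log L) ^ (1 / lam) ≤ 1 / (2 * H * Q) * n := by
    calc _ ≤ ((1 / (2 * H * Q) * n) ^ lam) ^ (1 / lam) := by gcongr
      _ = _ := by
        rw [← rpow_mul (by positivity), mul_one_div_cancel hlam.ne', rpow_one]
  have hlogv : log v = -L := by rw [hL, one_div, log_inv, neg_neg]
  rw [rpow_def_of_pos hv, hlogv]
  apply exp_le_exp.2
  calc -L * -(H * (L / log L) ^ (1 / lam)) = L * (H * (L / log L) ^ (1 / lam)) := by ring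
    _ ≤ (Q * logScale c lam n) * (H * (1 / (2 * H * Q) * n)) := by
        have := hL0.trans_le hLQ
        gcongr
    _ = _ := by field_simp

lemma exists_bound_of_growth {lam H : ℝ} (hlam : 0 < lam) (hH : 0 < H) :
    ∃ κ : ℝ, 0 < κ ∧ ∀ ρ y T : ℝ, 0 < y → 0 < T → ∃ t₀ B : ℝ, 0 < t₀ ∧ t₀ < T ∧ 0 ≤ B ∧
      ∀ (I : ℕ → ℝ → ℂ) (C : ℝ), 0 ≤ C →
        (∀ k, ∀ x, 0 < x → x < T → HasDerivAt (I k) (I (k + 1) x) x) →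
        (∀ (k : ℕ) (x : ℝ), 0 < x → x < T → ‖I k x‖ ≤
          C * exp (ρ * k + κ * (k : ℝ) ^ (lam + 1) * log k) *
            (x * y) ^ (-(H * (log (1 / (x * y)) / log (log (1 / (x * y)))) ^ (1 / lam)))) →
        ∀ t, 0 < t → t ≤ t₀ → ‖I 0 t‖ ≤ B * C := by
  obtain ⟨c, hc⟩ : ∃ c : ℝ, c = lam / 2 ^ (lam + 1) * (1 / (2 * H * 2 ^ (lam + 1))) ^ lam :=
    ⟨_, rfl⟩
  have hc0 : 0 < c := by rw [hc]; positivity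
  refine ⟨c / 4, by positivity, fun ρ y T hy hT => ?_⟩
  set ℓ := logScale c lam with hℓ
  set s : ℕ → ℝ := fun n => exp (-ℓ n) / y with hs
  have hslim : Filter.Tendsto s Filter.atTop (𝓝 0) := by
    have := (tendsto_exp_neg_atTop_nhds_zero.comp (tendsto_logScale hc0 hlam)).div_const y
    simpa using this
  have hlogc : Filter.Tendsto (fun n : ℕ => c * log n) Filter.atTop Filter.atTop :=
    (tendsto_log_atTop.comp tendsto_natCast_atTop_atTop).const_mul_atTop hc0
  obtain ⟨N, hN⟩ := Filter.eventually_atTop.1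
    ((((Filter.eventually_ge_atTop 2).and (hlogc.eventually_ge_atTop 1)).and
      (hslim.eventually (gt_mem_nhds hT))).and
      ((tendsto_logScale hc0 hlam).eventually_ge_atTop (4 * (ρ - log y + 1))))
  have hs0 : ∀ n, 0 < s n := fun n => by simp only [hs]; positivity
  set a : ℕ → ℝ := fun k => exp (ρ * k + c / 4 * (k : ℝ) ^ (lam + 1) * log k) with ha
  set M : ℝ → ℝ := fun x =>
    (x * y) ^ (-(H * (log (1 / (x * y)) / log (log (1 / (x * y)))) ^ (1 / lam))) with hM
  have hM0 : ∀ x, 0 < x → 0 ≤ M x := fun x hx => by simp only [hM]; positivity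
  have hsum : Summable (fun n : ℕ => 2 * exp (-n)) := Real.summable_exp_neg_nat.mul_left 2
  refine ⟨s N, (∑ k ∈ Finset.range N, a k * M (s N) * s N ^ k) + ∑' n : ℕ, 2 * exp (-n),
    hs0 N, (hN N le_rfl).1.2, ?_, ?_⟩
  · refine add_nonneg (Finset.sum_nonneg fun k _ => ?_) (tsum_nonneg fun n => by positivity)
    have := hM0 _ (hs0 N)
    have := (hs0 N).le
    positivity
  intro I C hC hI hbd t ht htN
  have hb : ∀ n, N ≤ n → ∀ x, s (n + 1) ≤ x → x ≤ s n →
      ‖I n x‖ ≤ C * a n * exp (n * ℓ n / 2) := by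
    intro n hn x hx1 hx2
    have hx0 : 0 < x := (hs0 _).trans_le hx1
    refine (hbd n x hx0 (hx2.trans_lt (hN n hn).1.2)).trans ?_
    have hv : 0 < x * y := by positivity
    have key := growth_le hlam hH hc (hN n hn).1.1.1 (hN n hn).1.1.2 hv ?_ ?_
    · gcongr
    · rw [one_div, log_inv, le_neg, log_le_iff_le_exp hv]
      exact (le_div_iff₀ hy).1 hx2
    · rw [one_div, log_inv, neg_le, le_log_iff_exp_le hv]
      exact (div_le_iff₀ hy).1 hx1
  have hterm : ∀ n, N ≤ n → 2 * (C * a n * exp (n * ℓ n / 2) * s n ^ n) ≤ C * (2 * exp (-n)) := by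
    intro n hn
    have hn2 : 2 ≤ n := (hN n hn).1.1.1
    have hn0 : (0 : ℝ) < n := by exact_mod_cast (by omega : 0 < n)
    have hsn : s n ^ n = exp (n * (-ℓ n - log y)) := by
      rw [exp_nat_mul, exp_sub, exp_log hy]
    have hnl : c / 4 * (n : ℝ) ^ (lam + 1) * log n = n * ℓ n / 4 := by
      rw [hℓ, logScale, rpow_add hn0, rpow_one]; ring
    have h4 : 4 * (ρ - log y + 1) ≤ ℓ n := (hN n hn).2
    have hprod : a n * exp (n * ℓ n / 2) * s n ^ n ≤ exp (-n) := by
      simp only [ha]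
      rw [hsn, hnl, ← exp_add, ← exp_add]
      apply exp_le_exp.2
      nlinarith [mul_le_mul_of_nonneg_left h4 hn0.le]
    calc _ = C * (2 * (a n * exp (n * ℓ n / 2) * s n ^ n)) := by ring
      _ ≤ _ := by gcongr
  have hS : ∀ n, ∑ k ∈ Finset.Ico N n, 2 * (C * a k * exp (k * ℓ k / 2) * s k ^ k) ≤
      C * ∑' n : ℕ, 2 * exp (-n) := by
    intro n
    calc _ ≤ ∑ k ∈ Finset.Ico N n, C * (2 * exp (-k)) :=
          Finset.sum_le_sum fun k hk => hterm k (Finset.mem_Ico.1 hk).1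
      _ = C * ∑ k ∈ Finset.Ico N n, 2 * exp (-k) := by rw [Finset.mul_sum]
      _ ≤ _ := by
        gcongr
        exact hsum.sum_le_tsum _ fun _ _ => by positivity
  have hanti : ∀ n, N ≤ n → s (n + 1) ≤ s n := fun n hn => by
    have := logScale_mono hc0 hlam (one_le_two.trans (hN n hn).1.1.1) n.le_succ
    simp only [hs]
    gcongr
  have := norm_le_of_scales hI (one_le_two.trans (hN N le_rfl).1.1.1)
    (fun n hn => (hN n hn).1.2) hanti hslim hb hS ht htN
  refine this.trans ?_
  rw [add_mul, mul_comm C, Finset.sum_mul]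
  refine add_le_add_left (Finset.sum_le_sum fun k _ => ?_) _
  calc _ ≤ C * a k * M (s N) * s N ^ k :=
        mul_le_mul_of_nonneg_right (hbd k _ (hs0 N) (hN N le_rfl).1.2) (pow_nonneg (hs0 N).le _)
    _ = _ := by ring

end Scales

section DirectionalDerivatives

open scoped ContDiff

/-- The directional derivative of `f` in the direction `v`. -/
noncomputable def dirDer {d : ℕ} (v : Fin d → ℝ) (f : (Fin d → ℝ) → ℂ) : (Fin d → ℝ) → ℂ :=
  fun x => fderiv ℝ f x v

variable {d : ℕ} {f : (Fin d → ℝ) → ℂ}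

lemma ContDiff.dirDer (hf : ContDiff ℝ ∞ f) (v : Fin d → ℝ) : ContDiff ℝ ∞ (dirDer v f) :=
  (hf.fderiv_right (m := ∞) (by simp)).clm_apply contDiff_const

lemma ContDiff.dirDer_iterate (hf : ContDiff ℝ ∞ f) (v : Fin d → ℝ) (k : ℕ) :
    ContDiff ℝ ∞ ((_root_.dirDer v)^[k] f) := by
  induction k with
  | zero => exact hf
  | succ k ih => rw [Function.iterate_succ_apply']; exact ih.dirDer v

lemma dirDer_comm (hf : ContDiff ℝ ∞ f) (u v : Fin d → ℝ) :
    dirDer u (dirDer v f) = dirDer v (dirDer u f) := by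
  have h : ∀ a b x, dirDer a (dirDer b f) x = fderiv ℝ (fderiv ℝ f) x a b := fun a b x => by
    have hd : DifferentiableAt ℝ (fderiv ℝ f) x :=
      (hf.fderiv_right (m := ∞) (by simp)).differentiable (by simp) x
    change fderiv ℝ (fun y => fderiv ℝ f y b) x a = _
    rw [fderiv_clm_apply hd (differentiableAt_const b)]
    simp
  funext x
  rw [h, h]
  exact (hf.contDiffAt.isSymmSndFDerivAt (by
    simpa using WithTop.coe_le_coe.2 (le_top : (2 : ℕ∞) ≤ ⊤))) u v

lemma dirDer_iterate_comm (hf : ContDiff ℝ ∞ f) (u v : Fin d → ℝ) (k : ℕ) :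
    dirDer u ((dirDer v)^[k] f) = (dirDer v)^[k] (dirDer u f) := by
  induction k with
  | zero => rfl
  | succ k ih =>
    rw [Function.iterate_succ_apply', dirDer_comm (hf.dirDer_iterate v k), ih,
      Function.iterate_succ_apply']

lemma dirDer_sum {ι : Type*} (s : Finset ι) (c : ι → ℝ) {g : ι → (Fin d → ℝ) → ℂ}
    (hg : ∀ i, ContDiff ℝ ∞ (g i)) (v : Fin d → ℝ) :
    dirDer v (fun x => ∑ i ∈ s, (c i : ℂ) * g i x) =
      fun x => ∑ i ∈ s, (c i : ℂ) * dirDer v (g i) x := by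
  funext x
  have hd : ∀ i, DifferentiableAt ℝ (g i) x := fun i => (hg i).differentiable (by simp) x
  simp only [dirDer]
  rw [fderiv_fun_sum fun i _ => (hd i).const_mul _]
  simp only [sum_apply]
  refine Finset.sum_congr rfl fun i _ => ?_
  rw [fderiv_const_mul (hd i)]
  simp

lemma dirDer_iterate_sum {ι : Type*} (s : Finset ι) (c : ι → ℝ) {g : ι → (Fin d → ℝ) → ℂ}
    (hg : ∀ i, ContDiff ℝ ∞ (g i)) (v : Fin d → ℝ) (k : ℕ) :
    (dirDer v)^[k] (fun x => ∑ i ∈ s, (c i : ℂ) * g i x) =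
      fun x => ∑ i ∈ s, (c i : ℂ) * (dirDer v)^[k] (g i) x := by
  induction k with
  | zero => rfl
  | succ k ih =>
    simp only [Function.iterate_succ_apply']
    rw [ih, dirDer_sum s c (fun i => (hg i).dirDer_iterate v k)]

lemma dirDer_eq_sum (v : Fin d → ℝ) :
    dirDer v f = fun x => ∑ i, (v i : ℂ) * pder i f x := by
  funext x
  have hv : v = ∑ i, v i • (Pi.single i 1 : Fin d → ℝ) := by
    ext j; simp [Finset.sum_apply, Pi.single_apply]
  simp only [dirDer, pder]
  conv_lhs => rw [hv]
  rw [map_sum]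
  simp

lemma contDiff_foldr_pder (hf : ContDiff ℝ ∞ f) (α : Fin d → ℕ) (l : List (Fin d)) :
    ContDiff ℝ ∞ (l.foldr (fun i g => (pder i)^[α i] g) f) := by
  induction l with
  | nil => exact hf
  | cons j l ih => exact ih.dirDer_iterate _ _

lemma contDiff_mder (hf : ContDiff ℝ ∞ f) (α : Fin d → ℕ) : ContDiff ℝ ∞ (mder α f) :=
  contDiff_foldr_pder hf α _

lemma pder_foldr (hf : ContDiff ℝ ∞ f) (α : Fin d → ℕ) (i : Fin d) (l : List (Fin d))
    (hl : l.Nodup) :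
    (i ∉ l → l.foldr (fun j g => (pder j)^[(α + Pi.single i 1 : Fin d → ℕ) j] g) f =
      l.foldr (fun j g => (pder j)^[α j] g) f) ∧
    (i ∈ l → l.foldr (fun j g => (pder j)^[(α + Pi.single i 1 : Fin d → ℕ) j] g) f =
      pder i (l.foldr (fun j g => (pder j)^[α j] g) f)) := by
  induction l with
  | nil => simp
  | cons j l ih =>
    rw [List.nodup_cons] at hl
    obtain ⟨ih1, ih2⟩ := ih hl.2
    simp only [List.foldr_cons]
    constructor
    · intro hi
      rw [List.mem_cons, not_or] at hi
      rw [ih1 hi.2]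
      simp [Ne.symm hi.1]
    · intro hi
      rcases eq_or_ne i j with rfl | hij
      · rw [ih1 hl.1]
        simp only [Pi.add_apply, Pi.single_eq_same]
        rw [Function.iterate_succ_apply']
      · rw [ih2 ((List.mem_cons.1 hi).resolve_left hij)]
        simp only [Pi.add_apply, Pi.single_eq_of_ne' hij, add_zero]
        exact (dirDer_iterate_comm (contDiff_foldr_pder hf α l) _ _ _).symm

lemma pder_mder (hf : ContDiff ℝ ∞ f) (α : Fin d → ℕ) (i : Fin d) :
    pder i (mder α f) = mder (α + Pi.single i 1) f :=
  ((pder_foldr hf α i _ (List.nodup_finRange d)).2 (List.mem_finRange i)).symm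

lemma msize_add_single (α : Fin d → ℕ) (i : Fin d) : msize (α + Pi.single i 1) = msize α + 1 := by
  simp [msize, Finset.sum_add_distrib]

lemma mder_zero : mder 0 f = f := by
  simp [mder]

lemma norm_dirDer_iterate_mder_le (hf : ContDiff ℝ ∞ f) (v : Fin d → ℝ) {x : Fin d → ℝ}
    {M : ℕ → ℝ} (hM : ∀ β, ‖mder β f x‖ ≤ M (msize β)) (k : ℕ) (α : Fin d → ℕ) :
    ‖(dirDer v)^[k] (mder α f) x‖ ≤ (∑ i, |v i|) ^ k * M (msize α + k) := by
  induction k generalizing α with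
  | zero => simpa using hM α
  | succ k ih =>
    rw [Function.iterate_succ_apply, dirDer_eq_sum]
    simp only [pder_mder hf]
    rw [dirDer_iterate_sum _ _ fun i => contDiff_mder hf _]
    refine (norm_sum_le _ _).trans ?_
    rw [pow_succ', mul_assoc, Finset.sum_mul]
    refine Finset.sum_le_sum fun i _ => ?_
    rw [norm_mul, Complex.norm_real, Real.norm_eq_abs]
    refine mul_le_mul_of_nonneg_left ?_ (abs_nonneg _)
    have := ih (α + Pi.single i 1)
    rwa [msize_add_single, add_assoc, add_comm 1 k] at this

lemma norm_dirDer_iterate_le (hf : ContDiff ℝ ∞ f) (v : Fin d → ℝ) {x : Fin d → ℝ}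
    {M : ℕ → ℝ} (hM : ∀ β, ‖mder β f x‖ ≤ M (msize β)) (k : ℕ) :
    ‖(dirDer v)^[k] f x‖ ≤ (∑ i, |v i|) ^ k * M k := by
  have := norm_dirDer_iterate_mder_le hf v hM k 0
  rwa [mder_zero, show msize (0 : Fin d → ℕ) = 0 by simp [msize], zero_add] at this

lemma support_dirDer_subset {K : Set (Fin d → ℝ)} (hK : IsClosed K)
    (hf : Function.support f ⊆ K) (v : Fin d → ℝ) : Function.support (dirDer v f) ⊆ K := by
  intro x hx
  refine closure_minimal hf hK (support_fderiv_subset ℝ fun h => hx ?_)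
  simp [dirDer, h]

lemma support_dirDer_iterate_subset {K : Set (Fin d → ℝ)} (hK : IsClosed K)
    (hf : Function.support f ⊆ K) (v : Fin d → ℝ) (k : ℕ) :
    Function.support ((dirDer v)^[k] f) ⊆ K := by
  induction k with
  | zero => exact hf
  | succ k ih => rw [Function.iterate_succ_apply']; exact support_dirDer_subset hK ih v

lemma norm_mder_le_GNorm {τ σ : ℝ} (hσ : σ ≠ 0) {K : Set (Fin d → ℝ)}
    (hG : GNorm τ σ 1 K f ≠ ⊤) {x : Fin d → ℝ} (hx : x ∈ K) (α : Fin d → ℕ) :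
    ‖mder α f x‖ ≤
      (GNorm τ σ 1 K f).toReal * Real.exp (τ * (msize α : ℝ) ^ σ * Real.log (msize α)) := by
  have hexp : (msize α : ℝ) ^ (τ * (msize α : ℝ) ^ σ) =
      Real.exp (τ * (msize α : ℝ) ^ σ * Real.log (msize α)) := by
    rcases Nat.eq_zero_or_pos (msize α) with h | h
    · simp [h, Real.zero_rpow hσ]
    · rw [Real.rpow_def_of_pos (by exact_mod_cast h), mul_comm]
  have h1 : ENNReal.ofReal (‖mder α f x‖ /
      ((1 : ℝ) ^ ((msize α : ℝ) ^ σ) * (msize α : ℝ) ^ (τ * (msize α : ℝ) ^ σ))) ≤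
      GNorm τ σ 1 K f :=
    le_iSup_of_le α (le_iSup₂_of_le (f := fun x (_ : x ∈ K) => ENNReal.ofReal (‖mder α f x‖ /
      ((1 : ℝ) ^ ((msize α : ℝ) ^ σ) * (msize α : ℝ) ^ (τ * (msize α : ℝ) ^ σ)))) x hx le_rfl)
  rw [Real.one_rpow, one_mul, hexp, ENNReal.ofReal_le_iff_le_toReal hG,
    div_le_iff₀ (Real.exp_pos _)] at h1
  exact h1

end DirectionalDerivatives

section Pairing

open MeasureTheory Metric Set
open scoped ContDiff

variable {d : ℕ}

/-- The point `x + i t Y` of `ℂ^d`. -/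
noncomputable def tubePoint (Y : Fin d → ℝ) (x : Fin d → ℝ) (t : ℝ) : Fin d → ℂ :=
  fun i => (x i : ℂ) + (t * Y i : ℝ) * Complex.I

lemma continuous_tubePoint (Y : Fin d → ℝ) :
    Continuous fun p : (Fin d → ℝ) × ℝ => tubePoint Y p.1 p.2 := by
  unfold tubePoint
  fun_prop

lemma hasDerivAt_tubePoint (Y x : Fin d → ℝ) (t : ℝ) :
    HasDerivAt (tubePoint Y x) (Complex.I • fun i => (Y i : ℂ)) t := by
  rw [hasDerivAt_pi]
  intro i
  have h : HasDerivAt (fun t : ℝ => t * Y i) (Y i) t := by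
    simpa using (hasDerivAt_id t).mul_const (Y i)
  refine ((h.ofReal_comp.mul_const Complex.I).const_add (x i : ℂ)).congr_deriv ?_
  simp [mul_comm]

/-- The inclusion of `ℝ^d` into `ℂ^d`. -/
noncomputable def ofRealPi (d : ℕ) : (Fin d → ℝ) →L[ℝ] (Fin d → ℂ) :=
  ContinuousLinearMap.pi fun i => Complex.ofRealCLM.comp (ContinuousLinearMap.proj i)

lemma hasFDerivAt_tubePoint (Y x : Fin d → ℝ) (t : ℝ) :
    HasFDerivAt (fun x => tubePoint Y x t) (ofRealPi d) x :=
  (ofRealPi d).hasFDerivAt.add_const (fun i => ((t * Y i : ℝ) : ℂ) * Complex.I)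

lemma exists_norm_fderiv_le {F : (Fin d → ℂ) → ℂ} {Z Q : Set (Fin d → ℂ)} (hZ : IsOpen Z)
    (hF : DifferentiableOn ℂ F Z) (hQ : IsCompact Q) (hQZ : Q ⊆ Z) :
    ∃ C, ∀ z ∈ Q, ‖fderiv ℂ F z‖ ≤ C := by
  obtain ⟨δ, hδ, hsub⟩ := hQ.exists_cthickening_subset_open hZ hQZ
  obtain ⟨M, hM⟩ := (hQ.cthickening (r := δ)).exists_bound_of_continuousOn
    (hF.continuousOn.mono hsub)
  have hball : ∀ z ∈ Q, ball z δ ⊆ cthickening δ Q := fun z hz =>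
    (ball_subset_thickening hz δ).trans (thickening_subset_cthickening δ Q)
  refine ⟨2 * M / δ, fun z hz => Complex.norm_fderiv_le_div_of_mapsTo_ball
    (hF.mono ((hball z hz).trans hsub)) (fun w hw => ?_) hδ⟩
  rw [mem_closedBall, dist_eq_norm]
  calc _ ≤ ‖F w‖ + ‖F z‖ := norm_sub_le _ _
    _ ≤ 2 * M := by
      linarith [hM w (hball z hz hw), hM z (self_subset_cthickening Q hz)]

lemma continuousOn_tube {F : (Fin d → ℂ) → ℂ} {Z : Set (Fin d → ℂ)}
    (hF : DifferentiableOn ℂ F Z) {K : Set (Fin d → ℝ)} {Y : Fin d → ℝ} {t : ℝ}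
    (hK : ∀ x ∈ K, tubePoint Y x t ∈ Z) : ContinuousOn (fun x => F (tubePoint Y x t)) K :=
  hF.continuousOn.comp
    ((continuous_tubePoint Y).comp (Continuous.prodMk_left t)).continuousOn hK

lemma hasDerivAt_setIntegral_tube {F : (Fin d → ℂ) → ℂ} {Z : Set (Fin d → ℂ)} (hZ : IsOpen Z)
    (hF : DifferentiableOn ℂ F Z) {K : Set (Fin d → ℝ)} (hK : IsCompact K) {Y : Fin d → ℝ}
    {s : ℝ} (hs : ∀ x ∈ K, tubePoint Y x s ∈ Z) {ψ : (Fin d → ℝ) → ℂ} (hψ : ContDiff ℝ ∞ ψ)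
    (hsupp : Function.support ψ ⊆ K) :
    HasDerivAt (fun t => ∫ x in K, F (tubePoint Y x t) * ψ x)
      (-Complex.I * ∫ x in K, F (tubePoint Y x s) * dirDer Y ψ x) s := by
  have hcont := continuous_tubePoint Y
  have hmeasK : MeasurableSet K := hK.measurableSet
  obtain ⟨u, v, hu, hv, hKu, hsv, huv⟩ := generalized_tube_lemma hK (isCompact_singleton (x := s))
    (hZ.preimage hcont) (by
      rintro ⟨x, t⟩ ⟨hx, ht⟩
      rw [mem_singleton_iff] at ht
      subst ht
      exact hs x hx)
  obtain ⟨ε, hε, hεv⟩ := nhds_basis_closedBall.mem_iff.1 (hv.mem_nhds (hsv rfl))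
  have hmem : ∀ x ∈ K, ∀ t ∈ closedBall s ε, tubePoint Y x t ∈ Z := fun x hx t ht =>
    huv (show (x, t) ∈ u ×ˢ v from ⟨hKu hx, hεv ht⟩)
  have hdiff : ∀ x ∈ K, ∀ t ∈ closedBall s ε, DifferentiableAt ℂ F (tubePoint Y x t) :=
    fun x hx t ht => hF.differentiableAt (hZ.mem_nhds (hmem x hx t ht))
  obtain ⟨C, hC⟩ := exists_norm_fderiv_le hZ hF
    ((hK.prod (isCompact_closedBall s ε)).image hcont) (by
      rintro _ ⟨⟨x, t⟩, ⟨hx, ht⟩, rfl⟩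
      exact hmem x hx t ht)
  set w : Fin d → ℂ := fun i => (Y i : ℂ) with hw
  have hψint : ∀ {g : (Fin d → ℝ) → ℂ}, ContinuousOn g K →
      Integrable (fun x => g x * ψ x) (volume.restrict K) := fun hg =>
    (hg.mul hψ.continuous.continuousOn).integrableOn_compact hK
  have hmain := hasDerivAt_integral_of_dominated_loc_of_deriv_le (μ := volume.restrict K)
    (F := fun t x => F (tubePoint Y x t) * ψ x) (x₀ := s) (s := closedBall s ε)
    (F' := fun t x => fderiv ℂ F (tubePoint Y x t) (Complex.I • w) * ψ x)
    (bound := fun x => C * ‖Complex.I • w‖ * ‖ψ x‖)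
    (closedBall_mem_nhds s hε)
    (by
      filter_upwards [closedBall_mem_nhds s hε] with t ht
      exact (hψint (continuousOn_tube hF fun x hx => hmem x hx t ht)).aestronglyMeasurable)
    (hψint (continuousOn_tube hF hs))
    (by
      have h1 : Measurable fun x => fderiv ℂ F (tubePoint Y x s) (Complex.I • w) :=
        (measurable_fderiv_apply_const ℂ F (Complex.I • w)).comp
          (hcont.comp (Continuous.prodMk_left s)).measurable
      exact (h1.mul hψ.continuous.measurable).aestronglyMeasurable)
    (by
      filter_upwards [ae_restrict_mem hmeasK] with x hx t ht
      rw [norm_mul]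
      gcongr
      exact (ContinuousLinearMap.le_opNorm _ _).trans
        (by gcongr; exact hC _ ⟨(x, t), ⟨hx, ht⟩, rfl⟩))
    ((hψ.continuous.norm.const_mul _).continuousOn.integrableOn_compact hK)
    (by
      filter_upwards [ae_restrict_mem hmeasK] with x hx t ht
      exact (((hdiff x hx t ht).hasFDerivAt.restrictScalars ℝ).comp_hasDerivAt t
        (hasDerivAt_tubePoint Y x t)).mul_const (ψ x))
  refine hmain.2.congr_deriv ?_
  have hs' : s ∈ closedBall s ε := mem_closedBall_self hε.le
  have hf : ∀ x ∈ K, HasFDerivAt (fun x => F (tubePoint Y x s))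
      (((fderiv ℂ F (tubePoint Y x s)).restrictScalars ℝ).comp (ofRealPi d)) x := fun x hx =>
    ((hdiff x hx s hs').hasFDerivAt.restrictScalars ℝ).comp x (hasFDerivAt_tubePoint Y x s)
  have hderiv : ∀ x ∈ K, fderiv ℂ F (tubePoint Y x s) (Complex.I • w) =
      Complex.I * fderiv ℝ (fun x => F (tubePoint Y x s)) x Y := fun x hx => by
    rw [(hf x hx).fderiv, map_smul, smul_eq_mul]
    rfl
  have hts : tsupport ψ ⊆ K := closure_minimal hsupp hK.isClosed
  have hψ0 : ∀ x, x ∉ K → ψ x = 0 := fun x hx => by_contra fun h => hx (hsupp h)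
  have hdψ0 : ∀ x, x ∉ K → fderiv ℝ ψ x Y = 0 := fun x hx => by_contra fun h =>
    hx (support_dirDer_subset hK.isClosed hsupp Y h)
  have hI1 : Integrable (fun x => fderiv ℝ (fun x => F (tubePoint Y x s)) x Y * ψ x) := by
    refine (integrableOn_iff_integrable_of_support_subset (s := K) fun x hx => by_contra fun h =>
      hx (by simp [hψ0 x h])).1 ?_
    refine IntegrableOn.congr_fun (hmain.1.const_mul (-Complex.I)) (fun x hx => ?_) hmeasK
    simp only [hderiv x hx]
    linear_combination (-(fderiv ℝ (fun x => F (tubePoint Y x s)) x Y * ψ x)) * Complex.I_mul_I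
  have hI2 : Integrable (fun x => F (tubePoint Y x s) * fderiv ℝ ψ x Y) := by
    refine (integrableOn_iff_integrable_of_support_subset (s := K) fun x hx => by_contra fun h =>
      hx (by simp [hdψ0 x h])).1 ?_
    exact ((continuousOn_tube hF hs).mul
      (hψ.dirDer Y).continuous.continuousOn).integrableOn_compact hK
  have hI3 : Integrable (fun x => F (tubePoint Y x s) * ψ x) :=
    (integrableOn_iff_integrable_of_support_subset (s := K) fun x hx => by_contra fun h =>
      hx (by simp [hψ0 x h])).1 (hψint (continuousOn_tube hF hs))
  have hparts := integral_mul_fderiv_eq_neg_fderiv_mul_of_integrable hI1 hI2 hI3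
    (fun x hx => (hf x (hts hx)).differentiableAt)
    (fun x _ => hψ.differentiable (by simp) x)
  have h1 := setIntegral_eq_integral_of_forall_compl_eq_zero (s := K) (μ := volume)
    (f := fun x => F (tubePoint Y x s) * fderiv ℝ ψ x Y)
    (fun x hx => by rw [hdψ0 x hx, mul_zero])
  have h2 := setIntegral_eq_integral_of_forall_compl_eq_zero (s := K) (μ := volume)
    (f := fun x => fderiv ℝ (fun x => F (tubePoint Y x s)) x Y * ψ x)
    (fun x hx => by rw [hψ0 x hx, mul_zero])
  rw [← h1, ← h2] at hparts
  simp only [dirDer]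
  rw [hparts, neg_mul_neg, ← integral_const_mul]
  refine setIntegral_congr_fun hmeasK fun x hx => ?_
  simp only [hderiv x hx, mul_assoc]

end Pairing

section BoundaryValues

open Filter Set Metric
open scoped ContDiff

lemma exists_tendsto_of_norm_deriv_le {g g' : ℝ → ℂ} {t₀ M : ℝ} (ht₀ : 0 < t₀)
    (hg : ∀ t, 0 < t → t ≤ t₀ → HasDerivAt g (g' t) t)
    (hM : ∀ t, 0 < t → t ≤ t₀ → ‖g' t‖ ≤ M) : ∃ L, Tendsto g (𝓝[>] 0) (𝓝 L) := by
  have hlip : LipschitzOnWith M.toNNReal g (Ioc 0 t₀) :=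
    (convex_Ioc 0 t₀).lipschitzOnWith_of_nnnorm_hasDerivWithin_le
      (fun t ht => (hg t ht.1 ht.2).hasDerivWithinAt)
      fun t ht => NNReal.le_toNNReal_of_coe_le (hM t ht.1 ht.2)
  exact cauchy_map_iff_exists_tendsto.1 ((cauchy_nhds.mono nhdsWithin_le_nhds).map_of_le
    hlip.uniformContinuousOn (le_principal_iff.2 (Ioc_mem_nhdsGT ht₀)))

lemma exists_limit_of_growth {σ H : ℝ} (hσ : 1 < σ) (hH : 0 < H) :
    ∃ τ : ℝ, 0 < τ ∧ ∀ ρ y T : ℝ, 0 < y → 0 < T → ∃ B : ℝ, 0 ≤ B ∧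
      ∀ (I : ℕ → ℝ → ℂ) (C : ℝ), 0 ≤ C →
        (∀ k, ∀ x, 0 < x → x < T → HasDerivAt (I k) (I (k + 1) x) x) →
        (∀ (k : ℕ) (x : ℝ), 0 < x → x < T → ‖I k x‖ ≤
          C * Real.exp (ρ * k + τ * (k : ℝ) ^ σ * Real.log k) *
            (x * y) ^ (-(H * (Real.log (1 / (x * y)) /
              Real.log (Real.log (1 / (x * y)))) ^ (1 / (σ - 1))))) →
        ∃ L, Tendsto (I 0) (𝓝[>] 0) (𝓝 L) ∧ ‖L‖ ≤ B * C := by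
  obtain ⟨κ, hκ, h⟩ := exists_bound_of_growth (sub_pos.2 hσ) hH
  simp only [sub_add_cancel] at h
  set τ := κ / 2 ^ (σ + 1) with hτ
  have h2 : (1 : ℝ) ≤ 2 ^ (σ + 1) := Real.one_le_rpow (by norm_num) (by linarith)
  have hτ0 : 0 < τ := by positivity
  have hτκ : τ ≤ κ := div_le_self hκ.le h2
  have hpos : ∀ k : ℕ, 0 ≤ (k : ℝ) ^ σ * Real.log k := fun k =>
    mul_nonneg (by positivity) (Real.log_natCast_nonneg k)
  have hle : ∀ k : ℕ, τ * (k : ℝ) ^ σ * Real.log k ≤ κ * (k : ℝ) ^ σ * Real.log k := fun k => by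
    rw [mul_assoc, mul_assoc]
    exact mul_le_mul_of_nonneg_right hτκ (hpos k)
  have hsucc : ∀ k : ℕ, τ * ((k + 1 : ℕ) : ℝ) ^ σ * Real.log (k + 1 : ℕ) ≤
      κ + κ * (k : ℝ) ^ σ * Real.log k := by
    intro k
    have h0 : 0 ≤ κ * (k : ℝ) ^ σ * Real.log k := by
      rw [mul_assoc]; exact mul_nonneg hκ.le (hpos k)
    rcases lt_or_ge k 2 with hk | hk
    · interval_cases k
      · simp only [zero_add, Nat.cast_one, Real.log_one, mul_zero]; linarith
      · have hlog : Real.log 2 ≤ 1 := by linarith [Real.log_two_lt_d9]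
        have : τ * 2 ^ σ ≤ κ := by
          rw [hτ, div_mul_eq_mul_div, div_le_iff₀ (by positivity)]
          gcongr <;> linarith
        have : τ * 2 ^ σ * Real.log 2 ≤ κ * 1 := by gcongr
        simp only [Nat.reduceAdd, Nat.cast_ofNat]
        linarith
    · have := logScale_succ_le hτ0 (zero_lt_one.trans hσ) hk
      have he : 2 ^ (σ + 1) * logScale τ σ k = κ * (k : ℝ) ^ σ * Real.log k := by
        rw [logScale, hτ]; field_simp
      rw [he] at this
      exact this.trans (by linarith)
  refine ⟨τ, hτ0, fun ρ y T hy hT => ?_⟩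
  obtain ⟨t₀, B, ht₀, ht₀T, hB, hbound⟩ := h ρ y T hy hT
  refine ⟨B, hB, fun I C hC hI hbd => ?_⟩
  have hI0 := hbound I C hC hI fun k x hx hxT => (hbd k x hx hxT).trans (by
    gcongr C * Real.exp (_ + ?_) * _
    exact hle k)
  have hI1 := hbound (fun k => I (k + 1)) (C * Real.exp (ρ + κ)) (by positivity)
    (fun k => hI (k + 1)) fun k x hx hxT => (hbd (k + 1) x hx hxT).trans (by
      rw [mul_assoc C (Real.exp (ρ + κ)), ← Real.exp_add]
      gcongr C * Real.exp ?_ * _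
      have := hsucc k
      push_cast at this ⊢
      linarith)
  obtain ⟨L, hL⟩ := exists_tendsto_of_norm_deriv_le ht₀
    (fun t ht htt => hI 0 t ht (htt.trans_lt ht₀T)) hI1
  refine ⟨L, hL, le_of_tendsto hL.norm ?_⟩
  filter_upwards [Ioc_mem_nhdsGT ht₀] with t ht using hI0 t ht.1 ht.2

variable {d : ℕ}

lemma continuous_vnorm : Continuous (vnorm : (Fin d → ℝ) → ℝ) := by
  unfold vnorm
  fun_prop

lemma vnorm_smul {t : ℝ} (ht : 0 ≤ t) (y : Fin d → ℝ) : vnorm (t • y) = t * vnorm y := by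
  simp only [vnorm, Pi.smul_apply, smul_eq_mul, mul_pow]
  rw [← Finset.mul_sum, Real.sqrt_mul (sq_nonneg t), Real.sqrt_sq ht]

lemma vnorm_pos {y : Fin d → ℝ} (hy : y ≠ 0) : 0 < vnorm y := by
  obtain ⟨i, hi⟩ := Function.ne_iff.1 hy
  exact Real.sqrt_pos.2 (Finset.sum_pos' (fun i _ => sq_nonneg _)
    ⟨i, Finset.mem_univ i, by have : y i ≠ 0 := hi; positivity⟩)

lemma continuousAt_growth {H p v : ℝ} (hv0 : 0 < v) (hv : v < Real.exp (-Real.exp 1)) :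
    ContinuousAt (fun v : ℝ => v ^ (-(H * (Real.log (1 / v) /
      Real.log (Real.log (1 / v))) ^ p))) v := by
  have h1 : Real.exp 1 < Real.log (1 / v) := by
    rw [one_div, Real.log_inv, lt_neg]
    exact (Real.log_lt_iff_lt_exp hv0).2 hv
  have hlog0 : 0 < Real.log (1 / v) := (Real.exp_pos 1).trans h1
  have h2 : 0 < Real.log (Real.log (1 / v)) :=
    zero_lt_one.trans ((Real.lt_log_iff_exp_lt hlog0).2 h1)
  have hc1 : ContinuousAt (fun v : ℝ => Real.log (1 / v)) v :=
    (continuousAt_const.div continuousAt_id hv0.ne').log (one_div_pos.2 hv0).ne'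
  exact continuousAt_id.rpow
    (((hc1.div (hc1.log hlog0.ne') h2.ne').rpow_const (Or.inl (div_pos hlog0 h2).ne')).const_mul H).neg
    (Or.inl hv0.ne')

lemma differentiableOn_of_separately {F : (Fin d → ℂ) → ℂ} {Z : Set (Fin d → ℂ)}
    (hZ : IsOpen Z)
    (hsep : ∀ z ∈ Z, ∀ j, DifferentiableAt ℂ (fun w : ℂ => F (Function.update z j w)) (z j))
    {b : (Fin d → ℂ) → ℝ} (hb : ∀ z ∈ Z, ContinuousAt b z) (hFb : ∀ z ∈ Z, ‖F z‖ ≤ b z) :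
    DifferentiableOn ℂ F Z := by
  have hsep' : ∀ z ∈ Z, ∀ j, DifferentiableAt ℂ (fun w : ℂ => F (z + Pi.single j w)) 0 := by
    intro z hz j
    have h : (fun w : ℂ => F (z + Pi.single j w)) =
        (fun w : ℂ => F (Function.update z j w)) ∘ fun w => z j + w := by
      funext w
      refine congrArg F (funext fun i => ?_)
      rcases eq_or_ne i j with rfl | hij
      · simp
      · simp [hij]
    rw [h]
    refine DifferentiableAt.comp 0 ?_ (differentiableAt_id.const_add (z j))
    simpa using hsep z hz j
  intro z hz
  obtain ⟨ε, hε, hball⟩ := Metric.mem_nhds_iff.1 (inter_mem (hZ.mem_nhds hz)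
    ((hb z hz).eventually (gt_mem_nhds (lt_add_one (b z)))))
  refine (differentiableAt_of_separately hsep' (half_pos hε) (M := b z + 1) ?_
    ?_).differentiableWithinAt
  · rw [mul_div_cancel₀ _ two_ne_zero]
    exact fun w hw => (hball hw).1
  · rw [mul_div_cancel₀ _ two_ne_zero]
    exact fun w hw => (hFb w (hball hw).1).trans (hball hw).2.le

end BoundaryValues

/-- analytic functions with logarithmic-type growth
`|Im z|^{−H(ln(1/|Im z|)/ln ln(1/|Im z|))^{1/(σ−1)}}` have boundary values
acting continuously on test functions of class `σ` (for some indices `τ'', h`). -/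
theorem stmt12 (d : ℕ) (hd : 1 ≤ d) (σ γ : ℝ) (hσ : 1 < σ)
    (hγ0 : 0 < γ) (hγe : γ < 1 / Real.exp 1)
    (U : Set (Fin d → ℝ)) (hU : IsOpen U)
    (Γ : Set (Fin d → ℝ)) (hΓopen : IsOpen Γ) (hΓ0 : (0 : Fin d → ℝ) ∉ Γ)
    (hΓcone : ∀ y ∈ Γ, ∀ t : ℝ, 0 < t → t • y ∈ Γ)
    (F : (Fin d → ℂ) → ℂ)
    (hFanal : ∀ z : Fin d → ℂ,
      (fun i => (z i).re) ∈ U → (fun i => (z i).im) ∈ Γ →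
      vnorm (fun i => (z i).im) < γ →
      ∀ j : Fin d, AnalyticAt ℂ (fun w : ℂ => F (Function.update z j w)) (z j))
    (A H : ℝ) (hA : 0 < A) (hH : 0 < H)
    (hFbound : ∀ z : Fin d → ℂ,
      (fun i => (z i).re) ∈ U → (fun i => (z i).im) ∈ Γ →
      vnorm (fun i => (z i).im) < γ →
      vnorm (fun i => (z i).im) < Real.exp (-(Real.exp 1)) →
      ‖F z‖ ≤ A * (vnorm fun i => (z i).im) ^
        (-(H * (Real.log (1 / vnorm fun i => (z i).im) /
          Real.log (Real.log (1 / vnorm fun i => (z i).im))) ^ (1 / (σ - 1))))) :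
    ∀ K : Set (Fin d → ℝ), IsCompact K → K ⊆ U →
    ∀ Y ∈ Γ, vnorm Y < γ →
    ∃ τ'' h B : ℝ, 0 < τ'' ∧ 0 < h ∧ 0 < B ∧
      ∀ φ : (Fin d → ℝ) → ℂ, ContDiff ℝ (⊤ : ℕ∞) φ → Function.support φ ⊆ K →
        (∀ τ' h' : ℝ, 0 < τ' → 0 < h' → GNorm τ' σ h' K φ < ⊤) →
        ∃ L : ℂ,
          Filter.Tendsto
            (fun t : ℝ =>
              ∫ x in K, F (fun i => (x i : ℂ) + (t * Y i : ℝ) * Complex.I) * φ x)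
            (𝓝[>] (0 : ℝ)) (𝓝 L) ∧
          ‖L‖ ≤ B * (GNorm τ'' σ h K φ).toReal := by
  intro K hK hKU Y hY _
  set b : ℝ → ℝ := fun v =>
    v ^ (-(H * (Real.log (1 / v) / Real.log (Real.log (1 / v))) ^ (1 / (σ - 1))))
  set r : ℝ := min γ (Real.exp (-Real.exp 1))
  have hr0 : 0 < r := lt_min hγ0 (Real.exp_pos _)
  set re : (Fin d → ℂ) → Fin d → ℝ := fun z i => (z i).re with hre
  set im : (Fin d → ℂ) → Fin d → ℝ := fun z i => (z i).im with him
  have hrec : Continuous re := by fun_prop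
  have himc : Continuous im := by fun_prop
  set Z : Set (Fin d → ℂ) := {z | re z ∈ U ∧ im z ∈ Γ ∧ vnorm (im z) < r} with hZdef
  have hZ : IsOpen Z := (hU.preimage hrec).inter ((hΓopen.preimage himc).inter
    (isOpen_lt (continuous_vnorm.comp himc) continuous_const))
  have hne : ∀ y ∈ Γ, y ≠ 0 := fun y hy h => hΓ0 (h ▸ hy)
  have hF : DifferentiableOn ℂ F Z := by
    refine differentiableOn_of_separately hZ (b := fun z => A * b (vnorm (im z)))
      (fun z hz j => (hFanal z hz.1 hz.2.1 (hz.2.2.trans_le (min_le_left _ _)) j).differentiableAt)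
      (fun z hz => ?_)
      (fun z hz => hFbound z hz.1 hz.2.1 (hz.2.2.trans_le (min_le_left _ _))
        (hz.2.2.trans_le (min_le_right _ _)))
    have h := continuousAt_growth (H := H) (p := 1 / (σ - 1)) (vnorm_pos (hne _ hz.2.1))
      (hz.2.2.trans_le (min_le_right _ _))
    exact (h.comp (f := fun z => vnorm (im z))
      (continuous_vnorm.comp himc).continuousAt).const_mul A
  have hy : 0 < vnorm Y := vnorm_pos (hne Y hY)
  have himY : ∀ x s, im (tubePoint Y x s) = s • Y := fun x s => by
    funext i; simp [him, tubePoint]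
  have hreY : ∀ x s, re (tubePoint Y x s) = x := fun x s => by
    funext i; simp [hre, tubePoint]
  have hmem : ∀ s, 0 < s → s < r / vnorm Y → ∀ x ∈ K, tubePoint Y x s ∈ Z := by
    intro s hs hsT x hx
    refine ⟨by rw [hreY]; exact hKU hx, by rw [himY]; exact hΓcone Y hY s hs, ?_⟩
    rw [himY, vnorm_smul hs.le]
    exact (lt_div_iff₀ hy).1 hsT
  obtain ⟨τ, hτ, hlim⟩ := exists_limit_of_growth hσ hH
  set R : ℝ := ∑ i, |Y i|
  have hR0 : 0 ≤ R := Finset.sum_nonneg fun i _ => abs_nonneg _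
  obtain ⟨B, hB, hlim⟩ := hlim (Real.log (R + 1)) (vnorm Y) (r / vnorm Y) hy (div_pos hr0 hy)
  set V : ℝ := MeasureTheory.volume.real K
  have hV0 : 0 ≤ V := MeasureTheory.measureReal_nonneg
  refine ⟨τ, 1, B * (V * A) + 1, hτ, one_pos, by positivity, fun φ hφ hsupp hG => ?_⟩
  set G : ℝ := (GNorm τ σ 1 K φ).toReal
  have hG0 : 0 ≤ G := ENNReal.toReal_nonneg
  set I : ℕ → ℝ → ℂ := fun k s =>
    (-Complex.I) ^ k * ∫ x in K, F (tubePoint Y x s) * (dirDer Y)^[k] φ x with hI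
  have hder : ∀ k s, 0 < s → s < r / vnorm Y → HasDerivAt (I k) (I (k + 1) s) s := by
    intro k s hs hsT
    have h := (hasDerivAt_setIntegral_tube hZ hF hK (hmem s hs hsT) (hφ.dirDer_iterate Y k)
      (support_dirDer_iterate_subset hK.isClosed hsupp Y k)).const_mul ((-Complex.I) ^ k)
    refine h.congr_deriv ?_
    simp only [hI]
    rw [Function.iterate_succ_apply', pow_succ, mul_assoc]
  have hbd : ∀ (k : ℕ) (s : ℝ), 0 < s → s < r / vnorm Y → ‖I k s‖ ≤
      V * A * G * Real.exp (Real.log (R + 1) * k + τ * (k : ℝ) ^ σ * Real.log k) *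
        b (s * vnorm Y) := by
    intro k s hs hsT
    have hb0 : 0 ≤ b (s * vnorm Y) := Real.rpow_nonneg (by positivity) _
    have hpt : ∀ x ∈ K, ‖F (tubePoint Y x s) * (dirDer Y)^[k] φ x‖ ≤
        A * b (s * vnorm Y) * (R ^ k * (G * Real.exp (τ * (k : ℝ) ^ σ * Real.log k))) := by
      intro x hx
      have hz := hmem s hs hsT x hx
      have hFz := hFbound _ hz.1 hz.2.1 (hz.2.2.trans_le (min_le_left _ _))
        (hz.2.2.trans_le (min_le_right _ _))
      have hv : vnorm (fun i => (tubePoint Y x s i).im) = s * vnorm Y := by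
        rw [← vnorm_smul hs.le, ← himY x s]
      rw [hv] at hFz
      have hD := norm_dirDer_iterate_le hφ Y (x := x)
        (M := fun k => G * Real.exp (τ * (k : ℝ) ^ σ * Real.log k))
        (fun β => norm_mder_le_GNorm (by linarith) (hG τ 1 hτ one_pos).ne hx β) k
      rw [norm_mul]
      exact mul_le_mul hFz hD (norm_nonneg _) (by positivity)
    have hint := MeasureTheory.norm_setIntegral_le_of_norm_le_const
      (μ := MeasureTheory.volume) hK.measure_lt_top hpt
    have hRk : R ^ k ≤ Real.exp (Real.log (R + 1) * k) := by
      rw [mul_comm, Real.exp_nat_mul, Real.exp_log (by positivity)]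
      gcongr
      linarith
    rw [norm_mul, norm_pow, norm_neg, Complex.norm_I, one_pow, one_mul]
    refine hint.trans ?_
    rw [Real.exp_add]
    calc _ = V * A * G * (R ^ k * Real.exp (τ * (k : ℝ) ^ σ * Real.log k)) * b (s * vnorm Y) := by
          ring
      _ ≤ V * A * G * (Real.exp (Real.log (R + 1) * k) *
            Real.exp (τ * (k : ℝ) ^ σ * Real.log k)) * b (s * vnorm Y) := by gcongr
  obtain ⟨L, hL, hLB⟩ := hlim I (V * A * G) (by positivity) hder hbd
  have hI0 : I 0 = fun s => ∫ x in K, F (tubePoint Y x s) * φ x := by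
    funext s; simp [hI]
  rw [hI0] at hL
  refine ⟨L, hL, hLB.trans ?_⟩
  calc B * (V * A * G) = B * (V * A) * G := by ring
    _ ≤ _ := by gcongr; linarith
end

section
/- Let K ⊂ ℝ^d be compact, τ>0, σ>1. Let (a_α)_{α∈ℕ^d} be a family of smooth functions on ℝ^d such that for every L>0 and every h>0 there exists A>0 with sup_{x∈K} |∂^β a_α(x)| ≤ A · h^{|β|^σ} |β|^{τ|β|^σ} · L^{|α|^σ} / |α|^{2^{σ-1}τ|α|^σ} for all α, β ∈ ℕ^d with α ≠ 0, and sup_{x∈K}|∂^β a_0(x)| ≤ A h^{|β|^σ}|β|^{τ|β|^σ}. Let φ : ℝ^d → ℂ be smooth with ‖φ‖_{τ,σ,h';K} < ∞ for some h'>0. Then the series Σ_{α∈ℕ^d} a_α(x) ∂^α φ(x) converges absolutely and uniformly for x ∈ K to a smooth function g on the interior of K, and there exist h''>0 and C>0 such that ‖g‖_{2^{σ-1}τ,σ,h'';K'} ≤ C · ‖φ‖_{τ,σ,h';K} for every compact K' contained in the interior of K. -/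
open scoped ENNReal

/-- Iterated partial derivative along a word of coordinate directions, the head being applied
last. -/
noncomputable def lder {d : ℕ} (w : List (Fin d)) (f : (Fin d → ℝ) → ℂ) : (Fin d → ℝ) → ℂ :=
  w.foldr pder f

/-- The increasing word in which the letter `i` occurs `α i` times. -/
def word {d : ℕ} (α : Fin d → ℕ) : List (Fin d) :=
  (List.finRange d).flatMap fun i => List.replicate (α i) i

section WordDerivatives

variable {d : ℕ}

lemma lder_append (u v : List (Fin d)) (f : (Fin d → ℝ) → ℂ) :
    lder (u ++ v) f = lder u (lder v f) := by
  simp [lder, List.foldr_append]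

lemma lder_replicate (n : ℕ) (i : Fin d) (f : (Fin d → ℝ) → ℂ) :
    lder (List.replicate n i) f = (pder i)^[n] f := by
  induction n with
  | zero => rfl
  | succ n ih =>
    rw [List.replicate_succ, Function.iterate_succ_apply', ← ih]
    rfl

lemma mder_eq_lder (α : Fin d → ℕ) (f : (Fin d → ℝ) → ℂ) : mder α f = lder (word α) f := by
  unfold mder word
  induction List.finRange d with
  | nil => rfl
  | cons i l ih => rw [List.foldr_cons, ih, List.flatMap_cons, lder_append, lder_replicate]

lemma length_word (α : Fin d → ℕ) : (word α).length = msize α := by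
  simp [word, msize, List.length_flatMap, Fin.sum_univ_def]

lemma count_word (α : Fin d → ℕ) (i : Fin d) : (word α).count i = α i := by
  have : (word α).count i = ∑ j, (List.replicate (α j) j).count i := by
    simp [word, List.count_flatMap, Fin.sum_univ_def, Function.comp_def]
  rw [this]
  simp [List.count_replicate]

lemma contDiff_pder (i : Fin d) {f : (Fin d → ℝ) → ℂ} (hf : ContDiff ℝ (⊤ : ℕ∞) f) :
    ContDiff ℝ (⊤ : ℕ∞) (pder i f) :=
  (hf.fderiv_right (m := (⊤ : ℕ∞)) (by simp)).clm_apply contDiff_const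

lemma contDiff_lder (w : List (Fin d)) {f : (Fin d → ℝ) → ℂ} (hf : ContDiff ℝ (⊤ : ℕ∞) f) :
    ContDiff ℝ (⊤ : ℕ∞) (lder w f) := by
  induction w with
  | nil => exact hf
  | cons i w ih => exact contDiff_pder i ih

lemma pder_comm (i j : Fin d) {f : (Fin d → ℝ) → ℂ} (hf : ContDiff ℝ (⊤ : ℕ∞) f) :
    pder i (pder j f) = pder j (pder i f) := by
  have key : ∀ (k l : Fin d) (x : Fin d → ℝ), pder k (pder l f) x =
      fderiv ℝ (fderiv ℝ f) x (Pi.single k 1) (Pi.single l 1) := by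
    intro k l x
    have hd : DifferentiableAt ℝ (fderiv ℝ f) x :=
      (hf.fderiv_right (m := (⊤ : ℕ∞)) (by simp)).differentiable (by simp) x
    change fderiv ℝ (fun y => fderiv ℝ f y (Pi.single l 1)) x (Pi.single k 1) = _
    rw [fderiv_clm_apply hd (by fun_prop)]
    simp
  funext x
  rw [key, key]
  have hs : IsSymmSndFDerivAt ℝ f x := hf.contDiffAt.isSymmSndFDerivAt (by
    rw [minSmoothness_of_isRCLikeNormedField]
    exact WithTop.coe_le_coe.2 (le_top : (2 : ℕ∞) ≤ ⊤))
  exact hs _ _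

lemma lder_perm {u v : List (Fin d)} (h : u.Perm v) {f : (Fin d → ℝ) → ℂ}
    (hf : ContDiff ℝ (⊤ : ℕ∞) f) : lder u f = lder v f := by
  induction h with
  | nil => rfl
  | cons i _ ih =>
    change pder i (lder _ f) = pder i (lder _ f)
    rw [ih]
  | swap i j l => exact pder_comm j i (contDiff_lder l hf)
  | trans _ _ ih₁ ih₂ => exact ih₁.trans ih₂

lemma exists_lder_eq_mder (w : List (Fin d)) :
    ∃ α : Fin d → ℕ, msize α = w.length ∧
      ∀ f : (Fin d → ℝ) → ℂ, ContDiff ℝ (⊤ : ℕ∞) f → lder w f = mder α f := by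
  have hp : w.Perm (word fun i => w.count i) :=
    List.perm_iff_count.2 fun i => (count_word (fun i => w.count i) i).symm
  refine ⟨fun i => w.count i, ?_, fun f hf => ?_⟩
  · rw [← length_word, hp.length_eq]
  · rw [mder_eq_lder, lder_perm hp hf]

lemma pder_add (i : Fin d) {f g : (Fin d → ℝ) → ℂ} (hf : ContDiff ℝ (⊤ : ℕ∞) f)
    (hg : ContDiff ℝ (⊤ : ℕ∞) g) : pder i (f + g) = pder i f + pder i g := by
  funext x
  simp [pder, fderiv_add (hf.differentiable (by simp) x) (hg.differentiable (by simp) x)]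

lemma lder_add (w : List (Fin d)) {f g : (Fin d → ℝ) → ℂ} (hf : ContDiff ℝ (⊤ : ℕ∞) f)
    (hg : ContDiff ℝ (⊤ : ℕ∞) g) : lder w (f + g) = lder w f + lder w g := by
  induction w with
  | nil => rfl
  | cons i w ih =>
    change pder i (lder w (f + g)) = _
    rw [ih, pder_add i (contDiff_lder w hf) (contDiff_lder w hg)]
    rfl

lemma pder_mul (i : Fin d) {f g : (Fin d → ℝ) → ℂ} (hf : ContDiff ℝ (⊤ : ℕ∞) f)
    (hg : ContDiff ℝ (⊤ : ℕ∞) g) : pder i (f * g) = f * pder i g + pder i f * g := by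
  funext x
  simp [pder, fderiv_mul (hf.differentiable (by simp) x) (hg.differentiable (by simp) x),
    mul_comm]

/-- The Leibniz rule as a bound: a derivative of order `n` of a product has at most `2 ^ n`
terms. -/
lemma norm_lder_mul_le (w : List (Fin d)) {f g : (Fin d → ℝ) → ℂ}
    (hf : ContDiff ℝ (⊤ : ℕ∞) f) (hg : ContDiff ℝ (⊤ : ℕ∞) g) (x : Fin d → ℝ) (M : ℝ)
    (h : ∀ u v : List (Fin d), u.length + v.length = w.length →
      ‖lder u f x‖ * ‖lder v g x‖ ≤ M) :
    ‖lder w (f * g) x‖ ≤ 2 ^ w.length * M := by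
  induction w using List.reverseRecOn generalizing f g with
  | nil => simpa [lder] using h [] [] rfl
  | append_singleton w i ih =>
    have hfi := contDiff_pder i hf
    have hgi := contDiff_pder i hg
    have e : lder (w ++ [i]) (f * g) = lder w (f * pder i g) + lder w (pder i f * g) := by
      have e₁ := lder_add w (f := f * pder i g) (g := pder i f * g) (hf.mul hgi) (hfi.mul hg)
      rw [lder_append, ← e₁, ← pder_mul i hf hg]
      rfl
    have h₁ := ih hf hgi fun u v huv => by
      have := h u (v ++ [i]) (by simp; omega)
      rwa [lder_append v] at this
    have h₂ := ih hfi hg fun u v huv => by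
      have := h (u ++ [i]) v (by simp; omega)
      rwa [lder_append u] at this
    rw [e, Pi.add_apply, List.length_append, List.length_singleton, pow_succ]
    linarith [norm_add_le (lder w (f * pder i g) x) (lder w (pder i f * g) x)]

end WordDerivatives

section TermwiseDerivatives

variable {d : ℕ}

lemma clm_eq_sum_smulRight (T : (Fin d → ℝ) →L[ℝ] ℂ) :
    T = ∑ j, (ContinuousLinearMap.proj (R := ℝ) (φ := fun _ : Fin d => ℝ) j).smulRight
      (T (Pi.single j 1)) := by
  ext v
  conv_lhs => rw [pi_eq_sum_univ' v]
  simp [map_sum]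

lemma norm_clm_le_sum (T : (Fin d → ℝ) →L[ℝ] ℂ) : ‖T‖ ≤ ∑ j, ‖T (Pi.single j 1)‖ := by
  refine T.opNorm_le_bound (by positivity) fun v => ?_
  conv_lhs => rw [clm_eq_sum_smulRight T]
  rw [sum_apply, Finset.sum_mul]
  refine (norm_sum_le _ _).trans (Finset.sum_le_sum fun j _ => ?_)
  rw [ContinuousLinearMap.smulRight_apply, norm_smul, mul_comm]
  exact mul_le_mul_of_nonneg_left (norm_le_pi_norm v j) (norm_nonneg _)

variable {ι : Type*} {F : ι → (Fin d → ℝ) → ℂ} {U : Set (Fin d → ℝ)}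
  {u : List (Fin d) → ι → ℝ}

lemma hasFDerivAt_tsum_lder (hF : ∀ i, ContDiff ℝ (⊤ : ℕ∞) (F i)) (hU : IsOpen U)
    (hu : ∀ w, Summable (u w)) (hFu : ∀ w i, ∀ x ∈ U, ‖lder w (F i) x‖ ≤ u w i)
    (w : List (Fin d)) {x : Fin d → ℝ} (hx : x ∈ U) :
    HasFDerivAt (fun y => ∑' i, lder w (F i) y)
      (∑ j, (ContinuousLinearMap.proj (R := ℝ) (φ := fun _ : Fin d => ℝ) j).smulRight
        (∑' i, lder (j :: w) (F i) x)) x := by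
  have hb : ∀ i, ∀ y ∈ U, ‖fderiv ℝ (lder w (F i)) y‖ ≤ ∑ j, u (j :: w) i := fun i y hy =>
    (norm_clm_le_sum _).trans (Finset.sum_le_sum fun j _ => hFu (j :: w) i y hy)
  have hs : Summable fun i => ∑ j, u (j :: w) i := summable_sum fun j _ => hu (j :: w)
  have hd : HasFDerivAt (fun y => ∑' i, lder w (F i) y)
      (∑' i, fderiv ℝ (lder w (F i)) x) x := by
    refine hasFDerivAt_of_tendstoUniformlyOn hU (tendstoUniformlyOn_tsum hs hb)
      (fun s y _ => HasFDerivAt.fun_sum fun i _ =>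
        ((contDiff_lder w (hF i)).differentiable (by simp) y).hasFDerivAt)
      (fun y hy => ?_) hx
    exact (Summable.of_norm_bounded (hu w) fun i => hFu w i y hy).hasSum
  have hsum : Summable fun i => fderiv ℝ (lder w (F i)) x :=
    Summable.of_norm_bounded hs fun i => hb i x hx
  rw [clm_eq_sum_smulRight (∑' i, fderiv ℝ (lder w (F i)) x)] at hd
  have he : ∀ j, (∑' i, fderiv ℝ (lder w (F i)) x) (Pi.single j 1) =
      ∑' i, lder (j :: w) (F i) x := fun j =>
    ContinuousLinearMap.map_tsum (ContinuousLinearMap.apply ℝ ℂ (Pi.single j 1)) hsum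
  simpa only [he] using hd

lemma lder_tsum (hF : ∀ i, ContDiff ℝ (⊤ : ℕ∞) (F i)) (hU : IsOpen U)
    (hu : ∀ w, Summable (u w)) (hFu : ∀ w i, ∀ x ∈ U, ‖lder w (F i) x‖ ≤ u w i)
    (w : List (Fin d)) : ∀ x ∈ U, lder w (fun y => ∑' i, F i y) x = ∑' i, lder w (F i) x := by
  induction w with
  | nil => exact fun x _ => rfl
  | cons j w ih =>
    intro x hx
    have he : lder w (fun y => ∑' i, F i y) =ᶠ[nhds x] fun y => ∑' i, lder w (F i) y :=
      Filter.eventually_of_mem (hU.mem_nhds hx) ih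
    change fderiv ℝ (lder w fun y => ∑' i, F i y) x (Pi.single j 1) = _
    rw [he.fderiv_eq, (hasFDerivAt_tsum_lder hF hU hu hFu w hx).fderiv,
      sum_apply]
    simp [Pi.single_apply, ite_smul]

lemma contDiffOn_tsum_lder (hF : ∀ i, ContDiff ℝ (⊤ : ℕ∞) (F i)) (hU : IsOpen U)
    (hu : ∀ w, Summable (u w)) (hFu : ∀ w i, ∀ x ∈ U, ‖lder w (F i) x‖ ≤ u w i)
    (w : List (Fin d)) : ContDiffOn ℝ (⊤ : ℕ∞) (fun y => ∑' i, lder w (F i) y) U := by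
  refine contDiffOn_infty.2 fun n => ?_
  induction n generalizing w with
  | zero =>
    exact contDiffOn_zero.2 fun x hx =>
      (hasFDerivAt_tsum_lder hF hU hu hFu w hx).continuousAt.continuousWithinAt
  | succ n ih =>
    push_cast
    refine (contDiffOn_succ_iff_fderiv_of_isOpen hU).2 ⟨fun x hx =>
      (hasFDerivAt_tsum_lder hF hU hu hFu w hx).differentiableAt.differentiableWithinAt,
      by simp, ?_⟩
    refine ContDiffOn.congr (f := fun x => ∑ j, (ContinuousLinearMap.proj (R := ℝ)
      (φ := fun _ : Fin d => ℝ) j).smulRight (∑' i, lder (j :: w) (F i) x)) ?_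
      fun x hx => (hasFDerivAt_tsum_lder hF hU hu hFu w hx).fderiv
    exact ContDiffOn.sum fun j _ => contDiffOn_const.smulRight (ih (j :: w))

end TermwiseDerivatives

section Weights

/-- `n ^ (τ n ^ σ)` in exponential form, also at `n = 0`. -/
lemma natCast_rpow_rpow_eq_exp {σ : ℝ} (hσ : 1 < σ) (τ : ℝ) (n : ℕ) :
    (n : ℝ) ^ (τ * (n : ℝ) ^ σ) = Real.exp (τ * ((n : ℝ) ^ σ * Real.log n)) := by
  rcases Nat.eq_zero_or_pos n with rfl | hn
  · have : (0 : ℝ) ^ σ = 0 := Real.zero_rpow (by linarith)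
    simp [this]
  · rw [Real.rpow_def_of_pos (by exact_mod_cast hn)]
    ring_nf

lemma rpow_mul_log_add_le {σ : ℝ} (hσ : 1 < σ) (p q : ℕ) :
    (p : ℝ) ^ σ * Real.log ((p + q : ℕ) : ℝ) ≤
      (p : ℝ) ^ σ * Real.log p + ((p : ℝ) ^ σ + (q : ℝ) ^ σ) := by
  rcases Nat.eq_zero_or_pos p with rfl | hp
  · have h0 : (0 : ℝ) ^ σ = 0 := Real.zero_rpow (by linarith)
    have : 0 ≤ (q : ℝ) ^ σ := by positivity
    simpa [h0] using this
  · have hp' : (0 : ℝ) < p := by exact_mod_cast hp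
    have hlog : Real.log ((p + q : ℕ) : ℝ) ≤ Real.log p + q / p := by
      have e : ((p + q : ℕ) : ℝ) = p * (1 + q / p) := by
        push_cast
        field_simp
      rw [e, Real.log_mul hp'.ne' (by positivity)]
      linarith [Real.log_le_sub_one_of_pos (show (0 : ℝ) < 1 + q / p by positivity)]
    have hpq : (p : ℝ) ^ σ * (q / p) ≤ (p : ℝ) ^ σ + (q : ℝ) ^ σ := by
      have e : (p : ℝ) ^ σ * (q / p) = (p : ℝ) ^ (σ - 1) * q := by
        rw [Real.rpow_sub_one hp'.ne']
        ring
      rcases le_total q p with h | h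
      · have h1 : (q : ℝ) / p ≤ 1 := (div_le_one hp').2 (by exact_mod_cast h)
        have h2 : 0 ≤ (q : ℝ) ^ σ := by positivity
        have h3 : 0 ≤ (p : ℝ) ^ σ := by positivity
        nlinarith
      · have hq' : (0 : ℝ) < q := hp'.trans_le (by exact_mod_cast h)
        have h1 : (p : ℝ) ^ (σ - 1) ≤ (q : ℝ) ^ (σ - 1) :=
          Real.rpow_le_rpow hp'.le (by exact_mod_cast h) (by linarith)
        have h2 : (q : ℝ) ^ (σ - 1) * q = (q : ℝ) ^ σ := by
          rw [Real.rpow_sub_one hq'.ne']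
          field_simp
        have h3 : 0 ≤ (p : ℝ) ^ σ := by positivity
        rw [e]
        nlinarith
    calc (p : ℝ) ^ σ * Real.log ((p + q : ℕ) : ℝ)
        ≤ (p : ℝ) ^ σ * (Real.log p + q / p) := by gcongr
      _ ≤ _ := by rw [mul_add]; linarith

lemma natCast_add_rpow_le {σ : ℝ} (hσ : 1 < σ) (p q : ℕ) :
    ((p + q : ℕ) : ℝ) ^ σ ≤ 2 ^ (σ - 1) * ((p : ℝ) ^ σ + (q : ℝ) ^ σ) := by
  have := NNReal.rpow_add_le_mul_rpow_add_rpow (p : NNReal) (q : NNReal) hσ.le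
  exact_mod_cast this

lemma rpow_add_rpow_le_natCast {σ : ℝ} (hσ : 1 < σ) (p q : ℕ) :
    (p : ℝ) ^ σ + (q : ℝ) ^ σ ≤ ((p + q : ℕ) : ℝ) ^ σ := by
  have := NNReal.add_rpow_le_rpow_add (p : NNReal) (q : NNReal) hσ.le
  exact_mod_cast this

lemma natCast_le_rpow {σ : ℝ} (hσ : 1 < σ) (n : ℕ) : (n : ℝ) ≤ (n : ℝ) ^ σ := by
  rcases Nat.eq_zero_or_pos n with rfl | hn
  · simp [Real.zero_rpow (show σ ≠ 0 by linarith)]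
  · exact Real.self_le_rpow_of_one_le (by exact_mod_cast hn) hσ.le

lemma rpow_mul_log_natCast_add_le {σ : ℝ} (hσ : 1 < σ) (p q : ℕ) :
    ((p + q : ℕ) : ℝ) ^ σ * Real.log ((p + q : ℕ) : ℝ) ≤
      2 ^ (σ - 1) * ((p : ℝ) ^ σ * Real.log p + (q : ℝ) ^ σ * Real.log q) +
        2 ^ σ * ((p : ℝ) ^ σ + (q : ℝ) ^ σ) := by
  have h1 := rpow_mul_log_add_le hσ p q
  have h2 := rpow_mul_log_add_le hσ q p
  rw [add_comm q p] at h2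
  have h3 : (2 : ℝ) ^ σ = 2 ^ (σ - 1) * 2 := by
    rw [Real.rpow_sub_one two_ne_zero]
    ring
  have h4 : (0 : ℝ) ≤ 2 ^ (σ - 1) := by positivity
  calc ((p + q : ℕ) : ℝ) ^ σ * Real.log ((p + q : ℕ) : ℝ)
      ≤ 2 ^ (σ - 1) * ((p : ℝ) ^ σ + (q : ℝ) ^ σ) * Real.log ((p + q : ℕ) : ℝ) :=
        mul_le_mul_of_nonneg_right (natCast_add_rpow_le hσ p q) (Real.log_natCast_nonneg _)
    _ = 2 ^ (σ - 1) * ((p : ℝ) ^ σ * Real.log ((p + q : ℕ) : ℝ) +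
          (q : ℝ) ^ σ * Real.log ((p + q : ℕ) : ℝ)) := by ring
    _ ≤ 2 ^ (σ - 1) * ((p : ℝ) ^ σ * Real.log p + ((p : ℝ) ^ σ + (q : ℝ) ^ σ) +
          ((q : ℝ) ^ σ * Real.log q + ((q : ℝ) ^ σ + (p : ℝ) ^ σ))) := by gcongr
    _ = _ := by rw [h3]; ring

lemma rpow_mul_log_superadditive {σ : ℝ} (hσ : 1 < σ) (p q : ℕ) :
    (p : ℝ) ^ σ * Real.log p + (q : ℝ) ^ σ * Real.log q ≤
      ((p + q : ℕ) : ℝ) ^ σ * Real.log ((p + q : ℕ) : ℝ) := by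
  have mono : ∀ r s : ℕ, (r : ℝ) ^ σ * Real.log r ≤
      (r : ℝ) ^ σ * Real.log ((r + s : ℕ) : ℝ) := by
    intro r s
    rcases Nat.eq_zero_or_pos r with rfl | hr
    · simp [Real.zero_rpow (show σ ≠ 0 by linarith)]
    · gcongr
      omega
  have h1 := mono p q
  have h2 := mono q p
  rw [add_comm q p] at h2
  have h3 := mul_le_mul_of_nonneg_right (rpow_add_rpow_le_natCast hσ p q)
    (Real.log_natCast_nonneg (p + q))
  linarith

/-- Splitting of the weight of a sum, at the price of the factor `2 ^ (σ - 1)` in `τ`. -/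
lemma exists_weight_add_le {τ σ h : ℝ} (hτ : 0 < τ) (hσ : 1 < σ) (hh : 0 < h) :
    ∃ H : ℝ, 1 ≤ H ∧ ∀ p q : ℕ,
      h ^ (((p + q : ℕ) : ℝ) ^ σ) *
          ((p + q : ℕ) : ℝ) ^ (τ * ((p + q : ℕ) : ℝ) ^ σ) ≤
        H ^ ((p : ℝ) ^ σ) * (p : ℝ) ^ ((2 : ℝ) ^ (σ - 1) * τ * (p : ℝ) ^ σ) *
          (H ^ ((q : ℝ) ^ σ) * (q : ℝ) ^ ((2 : ℝ) ^ (σ - 1) * τ * (q : ℝ) ^ σ)) := by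
  refine ⟨Real.exp (2 ^ (σ - 1) * |Real.log h| + τ * 2 ^ σ),
    Real.one_le_exp (by positivity), fun p q => ?_⟩
  simp only [natCast_rpow_rpow_eq_exp hσ, ← Real.exp_mul, ← Real.exp_add]
  rw [Real.rpow_def_of_pos hh, ← Real.exp_add, Real.exp_le_exp]
  have h1 : Real.log h * ((p + q : ℕ) : ℝ) ^ σ ≤
      |Real.log h| * (2 ^ (σ - 1) * ((p : ℝ) ^ σ + (q : ℝ) ^ σ)) :=
    mul_le_mul (le_abs_self _) (natCast_add_rpow_le hσ p q) (by positivity) (abs_nonneg _)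
  have h2 := mul_le_mul_of_nonneg_left (rpow_mul_log_natCast_add_le hσ p q) hτ.le
  linarith

/-- Weights of the two parts of a sum are absorbed by the weight of the sum. -/
lemma weight_mul_weight_le {τ σ H : ℝ} (hτ : 0 < τ) (hσ : 1 < σ) (hH : 1 ≤ H) (p q : ℕ) :
    (p : ℝ) ^ (τ * (p : ℝ) ^ σ) *
        (H ^ ((q : ℝ) ^ σ) * (q : ℝ) ^ ((2 : ℝ) ^ (σ - 1) * τ * (q : ℝ) ^ σ)) ≤
      H ^ (((p + q : ℕ) : ℝ) ^ σ) *
        ((p + q : ℕ) : ℝ) ^ ((2 : ℝ) ^ (σ - 1) * τ * ((p + q : ℕ) : ℝ) ^ σ) := by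
  have h1 : H ^ ((q : ℝ) ^ σ) ≤ H ^ (((p + q : ℕ) : ℝ) ^ σ) := by
    refine Real.rpow_le_rpow_of_exponent_le hH ?_
    have : (0 : ℝ) ≤ (p : ℝ) ^ σ := by positivity
    linarith [rpow_add_rpow_le_natCast hσ p q]
  have h2 : (p : ℝ) ^ (τ * (p : ℝ) ^ σ) * (q : ℝ) ^ ((2 : ℝ) ^ (σ - 1) * τ * (q : ℝ) ^ σ) ≤
      ((p + q : ℕ) : ℝ) ^ ((2 : ℝ) ^ (σ - 1) * τ * ((p + q : ℕ) : ℝ) ^ σ) := by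
    simp only [natCast_rpow_rpow_eq_exp hσ, ← Real.exp_add]
    rw [Real.exp_le_exp]
    have h3 : (1 : ℝ) ≤ 2 ^ (σ - 1) := Real.one_le_rpow one_le_two (by linarith)
    have h4 : 0 ≤ τ * ((p : ℝ) ^ σ * Real.log p) :=
      mul_nonneg hτ.le (mul_nonneg (by positivity) (Real.log_natCast_nonneg p))
    have h5 := mul_le_mul_of_nonneg_left (rpow_mul_log_superadditive hσ p q)
      (show 0 ≤ (2 : ℝ) ^ (σ - 1) * τ by positivity)
    nlinarith
  calc _ = H ^ ((q : ℝ) ^ σ) * ((p : ℝ) ^ (τ * (p : ℝ) ^ σ) *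
        (q : ℝ) ^ ((2 : ℝ) ^ (σ - 1) * τ * (q : ℝ) ^ σ)) := by ring
    _ ≤ _ := by gcongr

lemma summable_half_pow_msize (d : ℕ) :
    Summable fun α : Fin d → ℕ => (1 / 2 : ℝ) ^ msize α := by
  refine summable_of_sum_le (c := 2 ^ d) (fun α => by positivity) fun s => ?_
  obtain ⟨n, hn⟩ : ∃ n, s ⊆ Fintype.piFinset fun _ : Fin d => Finset.range n := by
    refine ⟨s.sup msize + 1, fun α hα => Fintype.mem_piFinset.2 fun i => ?_⟩
    have h1 : α i ≤ msize α := Finset.single_le_sum (fun _ _ => Nat.zero_le _) (Finset.mem_univ i)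
    have h2 : msize α ≤ s.sup msize := Finset.le_sup hα
    exact Finset.mem_range.2 (by omega)
  calc ∑ α ∈ s, (1 / 2 : ℝ) ^ msize α
      ≤ ∑ α ∈ Fintype.piFinset fun _ : Fin d => Finset.range n, (1 / 2 : ℝ) ^ msize α :=
        Finset.sum_le_sum_of_subset_of_nonneg hn fun _ _ _ => by positivity
    _ = ∏ _i : Fin d, ∑ k ∈ Finset.range n, (1 / 2 : ℝ) ^ k := by
        rw [Finset.prod_univ_sum]
        exact Finset.sum_congr rfl fun α _ => (Finset.prod_pow_eq_pow_sum _ _ _).symm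
    _ ≤ ∏ _i : Fin d, (2 : ℝ) := Finset.prod_le_prod
        (fun _ _ => Finset.sum_nonneg fun _ _ => by positivity)
        (fun _ _ => sum_geometric_two_le n)
    _ = 2 ^ d := by simp

end Weights

lemma norm_lder_le_of_norm_mder_le {d : ℕ} {f : (Fin d → ℝ) → ℂ}
    (hf : ContDiff ℝ (⊤ : ℕ∞) f) {x : Fin d → ℝ} {B : ℕ → ℝ}
    (h : ∀ β, ‖mder β f x‖ ≤ B (msize β)) (w : List (Fin d)) : ‖lder w f x‖ ≤ B w.length := by
  obtain ⟨β, hβ, hw⟩ := exists_lder_eq_mder w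
  rw [hw f hf, ← hβ]
  exact h β

lemma norm_mder_le_of_GNorm_lt_top {d : ℕ} {τ σ h : ℝ} (hσ : 1 < σ) (hh : 0 < h)
    {K : Set (Fin d → ℝ)} {φ : (Fin d → ℝ) → ℂ} (hφ : GNorm τ σ h K φ < ⊤)
    (α : Fin d → ℕ) {x : Fin d → ℝ} (hx : x ∈ K) :
    ‖mder α φ x‖ ≤ (GNorm τ σ h K φ).toReal *
      (h ^ ((msize α : ℝ) ^ σ) * (msize α : ℝ) ^ (τ * (msize α : ℝ) ^ σ)) := by
  have hpos : 0 < h ^ ((msize α : ℝ) ^ σ) * (msize α : ℝ) ^ (τ * (msize α : ℝ) ^ σ) := by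
    rw [natCast_rpow_rpow_eq_exp hσ]
    positivity
  rw [← div_le_iff₀ hpos]
  refine (ENNReal.ofReal_le_iff_le_toReal hφ.ne).1 ?_
  exact le_iSup_of_le α (le_iSup₂_of_le x hx le_rfl)

/-- an ultradifferentiable operator `P(x,∂) = Σ_α a_α(x) ∂^α` of
class `(τ,σ)` maps a function with finite `(τ,σ,h')`-norm to a smooth function
of class `(2^{σ-1}τ, σ)`, with absolute and uniform convergence of the series
on `K` and a norm estimate on compacts of the interior of `K`. -/
theorem stmt17 (d : ℕ) (hd : 1 ≤ d) (K : Set (Fin d → ℝ)) (hK : IsCompact K)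
    (τ σ : ℝ) (hτ : 0 < τ) (hσ : 1 < σ)
    (a : (Fin d → ℕ) → (Fin d → ℝ) → ℂ) (ha : ∀ α, ContDiff ℝ (⊤ : ℕ∞) (a α))
    (haB : ∀ L h : ℝ, 0 < L → 0 < h → ∃ A : ℝ, 0 < A ∧
      (∀ α β : Fin d → ℕ, α ≠ 0 → ∀ x ∈ K,
        ‖mder β (a α) x‖ ≤
          A * (h ^ ((msize β : ℝ) ^ σ) * (msize β : ℝ) ^ (τ * (msize β : ℝ) ^ σ)) *
            (L ^ ((msize α : ℝ) ^ σ) /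
              (msize α : ℝ) ^ ((2 : ℝ) ^ (σ - 1) * τ * (msize α : ℝ) ^ σ))) ∧
      (∀ β : Fin d → ℕ, ∀ x ∈ K,
        ‖mder β (a 0) x‖ ≤
          A * (h ^ ((msize β : ℝ) ^ σ) * (msize β : ℝ) ^ (τ * (msize β : ℝ) ^ σ))))
    (φ : (Fin d → ℝ) → ℂ) (hφ : ContDiff ℝ (⊤ : ℕ∞) φ)
    (h' : ℝ) (hh' : 0 < h') (hφnorm : GNorm τ σ h' K φ < ⊤) :
    ∃ g : (Fin d → ℝ) → ℂ,
      (∀ x ∈ K, Summable fun α : Fin d → ℕ => ‖a α x * mder α φ x‖) ∧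
      TendstoUniformlyOn
        (fun (s : Finset (Fin d → ℕ)) (x : Fin d → ℝ) => ∑ α ∈ s, a α x * mder α φ x)
        g Filter.atTop K ∧
      ContDiffOn ℝ (⊤ : ℕ∞) g (interior K) ∧
      ∃ h'' C : ℝ, 0 < h'' ∧ 0 < C ∧
        ∀ K' : Set (Fin d → ℝ), IsCompact K' → K' ⊆ interior K →
          GNorm ((2 : ℝ) ^ (σ - 1) * τ) σ h'' K' g ≤
            ENNReal.ofReal C * GNorm τ σ h' K φ := by
  obtain ⟨H, hH1, hH⟩ := exists_weight_add_le hτ hσ hh'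
  have hH0 : 0 < H := by linarith
  obtain ⟨A, hA, hA1, hA0⟩ := haB (1 / (2 * H)) 1 (by positivity) one_pos
  set ρ : ℝ := (2 : ℝ) ^ (σ - 1) * τ with hρ
  set N : ℝ := (GNorm τ σ h' K φ).toReal with hN
  have hN0 : 0 ≤ N := ENNReal.toReal_nonneg
  have hwpos : ∀ n : ℕ, 0 < (n : ℝ) ^ (ρ * (n : ℝ) ^ σ) := fun n => by
    rw [natCast_rpow_rpow_eq_exp hσ]
    positivity
  have hab : ∀ α, ∀ x ∈ K, ∀ w : List (Fin d), ‖lder w (a α) x‖ ≤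
      A * (w.length : ℝ) ^ (τ * (w.length : ℝ) ^ σ) *
        ((1 / (2 * H)) ^ ((msize α : ℝ) ^ σ) / (msize α : ℝ) ^ (ρ * (msize α : ℝ) ^ σ)) := by
    intro α x hx w
    refine norm_lder_le_of_norm_mder_le (B := fun n => A * (n : ℝ) ^ (τ * (n : ℝ) ^ σ) *
      ((1 / (2 * H)) ^ ((msize α : ℝ) ^ σ) / (msize α : ℝ) ^ (ρ * (msize α : ℝ) ^ σ)))
      (ha α) (fun β => ?_) w
    by_cases hα : α = 0
    · have h0 : (0 : ℝ) ^ σ = 0 := Real.zero_rpow (by linarith)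
      have hm : msize (0 : Fin d → ℕ) = 0 := by simp [msize]
      simpa [hα, hm, h0] using hA0 β x hx
    · simpa using hA1 α β hα x hx
  have hφb : ∀ α, ∀ x ∈ K, ∀ w : List (Fin d), ‖lder w (mder α φ) x‖ ≤
      N * (H ^ ((msize α : ℝ) ^ σ) * (msize α : ℝ) ^ (ρ * (msize α : ℝ) ^ σ) *
        (H ^ ((w.length : ℝ) ^ σ) * (w.length : ℝ) ^ (ρ * (w.length : ℝ) ^ σ))) := by
    intro α x hx w
    rw [mder_eq_lder, ← lder_append]
    refine (norm_lder_le_of_norm_mder_le (B := fun n => N * (h' ^ ((n : ℝ) ^ σ) *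
      (n : ℝ) ^ (τ * (n : ℝ) ^ σ))) hφ
      (fun β => norm_mder_le_of_GNorm_lt_top hσ hh' hφnorm β hx) _).trans ?_
    rw [List.length_append, length_word, add_comm]
    exact mul_le_mul_of_nonneg_left (hH _ _) hN0
  have hF : ∀ α, ContDiff ℝ (⊤ : ℕ∞) (a α * mder α φ) := fun α => by
    rw [mder_eq_lder]
    exact (ha α).mul (contDiff_lder _ hφ)
  set M : ℕ → ℝ := fun n =>
    2 ^ n * (A * N * (H ^ ((n : ℝ) ^ σ) * (n : ℝ) ^ (ρ * (n : ℝ) ^ σ))) with hM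
  have hFb : ∀ (w : List (Fin d)) (α : Fin d → ℕ), ∀ x ∈ K,
      ‖lder w (a α * mder α φ) x‖ ≤ M w.length * (1 / 2) ^ msize α := by
    intro w α x hx
    have hsm : ContDiff ℝ (⊤ : ℕ∞) (mder α φ) := by
      rw [mder_eq_lder]
      exact contDiff_lder _ hφ
    rw [hM, mul_assoc]
    refine norm_lder_mul_le w (ha α) hsm x _ fun u v huv => ?_
    have hL : (1 / (2 * H)) ^ ((msize α : ℝ) ^ σ) * H ^ ((msize α : ℝ) ^ σ) ≤
        (1 / 2) ^ msize α := by
      rw [← Real.mul_rpow (by positivity) hH0.le, ← Real.rpow_natCast (1 / 2),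
        show 1 / (2 * H) * H = 1 / 2 by field_simp]
      exact Real.rpow_le_rpow_of_exponent_ge (by norm_num) (by norm_num)
        (natCast_le_rpow hσ (msize α))
    have hW := weight_mul_weight_le hτ hσ hH1 u.length v.length
    rw [huv, ← hρ] at hW
    have hv := hwpos v.length
    have hp := hwpos (msize α)
    calc ‖lder u (a α) x‖ * ‖lder v (mder α φ) x‖
        ≤ _ * _ := mul_le_mul (hab α x hx u) (hφb α x hx v) (norm_nonneg _) (by positivity)
      _ = A * N * ((u.length : ℝ) ^ (τ * (u.length : ℝ) ^ σ) *
            (H ^ ((v.length : ℝ) ^ σ) * (v.length : ℝ) ^ (ρ * (v.length : ℝ) ^ σ))) *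
            ((1 / (2 * H)) ^ ((msize α : ℝ) ^ σ) * H ^ ((msize α : ℝ) ^ σ)) := by
          generalize (msize α : ℝ) ^ (ρ * (msize α : ℝ) ^ σ) = P at hp
          field_simp
      _ ≤ A * N * (H ^ ((w.length : ℝ) ^ σ) * (w.length : ℝ) ^ (ρ * (w.length : ℝ) ^ σ)) *
            (1 / 2) ^ msize α := by gcongr
  have hS := summable_half_pow_msize d
  have hu : ∀ w : List (Fin d), Summable fun α : Fin d → ℕ =>
      M w.length * (1 / 2 : ℝ) ^ msize α := fun w => hS.mul_left _
  have hFi : ∀ (w : List (Fin d)) (α : Fin d → ℕ), ∀ x ∈ interior K,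
      ‖lder w (a α * mder α φ) x‖ ≤ M w.length * (1 / 2) ^ msize α :=
    fun w α x hx => hFb w α x (interior_subset hx)
  set S : ℝ := ∑' α : Fin d → ℕ, (1 / 2 : ℝ) ^ msize α with hS'
  have hSpos : 0 < S := hS.tsum_pos (fun α => by positivity) 0 (by positivity)
  refine ⟨fun x => ∑' α, (a α * mder α φ) x, fun x hx => ?_, ?_, ?_,
    2 * H, A * S, by positivity, by positivity, fun K' _ hK' => ?_⟩
  · exact Summable.of_nonneg_of_le (fun _ => norm_nonneg _) (fun α => hFb [] α x hx) (hu [])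
  · exact tendstoUniformlyOn_tsum (hu []) fun α x hx => hFb [] α x hx
  · exact contDiffOn_tsum_lder hF isOpen_interior hu hFi []
  · refine iSup_le fun β => iSup₂_le fun x hx => ?_
    have hxi := hK' hx
    rw [← ENNReal.ofReal_toReal hφnorm.ne, ← hN, ← ENNReal.ofReal_mul (by positivity)]
    refine ENNReal.ofReal_le_ofReal ?_
    have hb := hwpos (msize β)
    rw [div_le_iff₀ (by positivity), mder_eq_lder,
      lder_tsum hF isOpen_interior hu hFi (word β) x hxi]
    have h2 : (2 : ℝ) ^ msize β ≤ 2 ^ ((msize β : ℝ) ^ σ) := by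
      rw [← Real.rpow_natCast]
      exact Real.rpow_le_rpow_of_exponent_le one_le_two (natCast_le_rpow hσ _)
    calc ‖∑' α, lder (word β) (a α * mder α φ) x‖
        ≤ ∑' α : Fin d → ℕ, M (word β).length * (1 / 2 : ℝ) ^ msize α :=
          tsum_of_norm_bounded (hu (word β)).hasSum fun α => hFi (word β) α x hxi
      _ = A * S * N * (2 ^ msize β * H ^ ((msize β : ℝ) ^ σ) *
            (msize β : ℝ) ^ (ρ * (msize β : ℝ) ^ σ)) := by
          rw [tsum_mul_left, length_word, hM]
          ring
      _ ≤ A * S * N * (2 ^ ((msize β : ℝ) ^ σ) * H ^ ((msize β : ℝ) ^ σ) *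
            (msize β : ℝ) ^ (ρ * (msize β : ℝ) ^ σ)) := by gcongr
      _ = _ := by rw [Real.mul_rpow two_pos.le hH0.le]
end
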